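/- arXiv:math/0502101 — 2 statements merged into one kernel-verified Lean document; each statement's English description precedes it below -/
import Mathlib

section
/- Let G be a GFERF word hyperbolic group and let G_1, G_2, ..., G_s be quasiconvex subgroups of G, where s is a positive integer. Then the product set G_1 G_2 ⋯ G_s = {g_1 g_2 ⋯ g_s : g_i ∈ G_i} is separable in G, i.e. closed in the profinite topology on G. -/
open scoped Pointwise

/-- `S` is a finite symmetrized generating set of the group `G`. -/
def IsSymmGenSet {G : Type*} [Group G] (S : Set G) : Prop :=
  S.Finite ∧ S⁻¹ = S ∧ Subgroup.closure S = ⊤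

/-- The word length of `g` with respect to the generating set `S`: the length of a
shortest word over `S` representing `g`. -/
noncomputable def wordLength {G : Type*} [Group G] (S : Set G) (g : G) : ℕ :=
  sInf {n : ℕ | ∃ f : Fin n → G, (∀ i, f i ∈ S) ∧ (List.ofFn f).prod = g}

/-- The left-invariant word metric `d(x,y) = |x⁻¹y|_G` on `G`. -/
noncomputable def wordDist {G : Type*} [Group G] (S : Set G) (x y : G) : ℕ :=
  wordLength S (x⁻¹ * y)

/-- The Gromov product `(x|y)_w = (d(x,w)+d(y,w)-d(x,y))/2`. -/
noncomputable def gromovProd {G : Type*} [Group G] (S : Set G) (x y w : G) : ℝ :=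
  ((wordDist S w x : ℝ) + (wordDist S w y : ℝ) - (wordDist S x y : ℝ)) / 2

/-- A discrete geodesic from `u` to `v` in the Cayley graph `Γ(G,S)`: a sequence of
vertices `p 0 = u, ..., p (d(u,v)) = v` with `d(p i, p j) = j - i`. -/
def IsGeodesic {G : Type*} [Group G] (S : Set G) (u v : G) (p : ℕ → G) : Prop :=
  p 0 = u ∧ p (wordDist S u v) = v ∧
    ∀ i j : ℕ, i ≤ j → j ≤ wordDist S u v → wordDist S (p i) (p j) = j - i

/-- A subset `Q ⊆ G` is `ε`-quasiconvex if every geodesic between two elements of `Q`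
lies in the closed `ε`-neighborhood of `Q`. -/
def IsQuasiconvex {G : Type*} [Group G] (S : Set G) (ε : ℝ) (Q : Set G) : Prop :=
  ∀ u ∈ Q, ∀ v ∈ Q, ∀ p : ℕ → G, IsGeodesic S u v p →
    ∀ i ≤ wordDist S u v, ∃ q ∈ Q, (wordDist S (p i) q : ℝ) ≤ ε

/-- All geodesic triangles in `Γ(G,S)` are `δ`-thin: two points on the sides of a
geodesic triangle, equidistant from a common vertex (within the Gromov product),
are at distance at most `δ` from each other. -/
def ThinTriangles {G : Type*} [Group G] (S : Set G) (δ : ℝ) : Prop :=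
  ∀ a b c : G, ∀ p q : ℕ → G, IsGeodesic S a b p → IsGeodesic S a c q →
    ∀ i : ℕ, (i : ℝ) ≤ gromovProd S b c a → (wordDist S (p i) (q i) : ℝ) ≤ δ

/-- The profinite topology on `G`: cosets of finite index normal subgroups form a
basis of open sets (equivalently, a basis of neighborhoods of the identity). -/
def profiniteTopology (G : Type*) [Group G] : TopologicalSpace G :=
  TopologicalSpace.generateFrom
    {U : Set G | ∃ (g : G) (N : Subgroup G), N.Normal ∧ N.FiniteIndex ∧ U = g • (N : Set G)}

/-- A subset of `G` is separable if it is closed in the profinite topology on `G`. -/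
def SeparableSubset (G : Type*) [Group G] (P : Set G) : Prop :=
  @IsClosed G (profiniteTopology G) P

/-- A word hyperbolic group `G` (with finite symmetrized generating set `S`) is GFERF
if every quasiconvex subgroup of `G` is separable. -/
def GFERF {G : Type*} [Group G] (S : Set G) : Prop :=
  ∀ H : Subgroup G, (∃ ε : ℝ, 0 ≤ ε ∧ IsQuasiconvex S ε (H : Set G)) →
    SeparableSubset G (H : Set G)

/-- A `(λ,c)`-quasigeodesic path of length `n` in the Cayley graph `Γ(G,S)`:
consecutive vertices are adjacent and every subpath `p|_{[i,j]}` satisfies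
`λ(j-i) - c ≤ d(p i, p j)`. -/
def IsQuasigeodesicOn {G : Type*} [Group G] (S : Set G) (lam c : ℝ) (p : ℕ → G) (n : ℕ) : Prop :=
  (∀ i < n, wordDist S (p i) (p (i + 1)) = 1) ∧
    ∀ i j : ℕ, i ≤ j → j ≤ n → lam * ((j : ℝ) - (i : ℝ)) - c ≤ (wordDist S (p i) (p j) : ℝ)

section WordMetric

variable {G : Type*} [Group G] {S : Set G}

theorem IsSymmGenSet.exists_list (hS : IsSymmGenSet S) (g : G) :
    ∃ l : List G, (∀ x ∈ l, x ∈ S) ∧ l.prod = g ∧ l.length = wordLength S g := by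
  obtain ⟨-, hinv, hgen⟩ := hS
  have hne : {n : ℕ | ∃ f : Fin n → G, (∀ i, f i ∈ S) ∧ (List.ofFn f).prod = g}.Nonempty := by
    have hg : g ∈ Subgroup.closure S := hgen ▸ Subgroup.mem_top g
    have key : ∃ l : List G, (∀ x ∈ l, x ∈ S) ∧ l.prod = g := by
      induction hg using Subgroup.closure_induction_left with
      | one => exact ⟨[], by simp, rfl⟩
      | mul_left x hx y _ ih =>
        obtain ⟨l, hl, rfl⟩ := ih
        exact ⟨x :: l, by simpa using ⟨hx, hl⟩, by simp⟩
      | inv_mul_cancel x hx y _ ih =>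
        obtain ⟨l, hl, rfl⟩ := ih
        have hx' : x⁻¹ ∈ S := by rw [← hinv]; simpa using hx
        exact ⟨x⁻¹ :: l, by simpa using ⟨hx', hl⟩, by simp⟩
    obtain ⟨l, hl, rfl⟩ := key
    exact ⟨l.length, l.get, fun i => hl _ (l.get_mem i), by simp⟩
  obtain ⟨f, hf, hfg⟩ := Nat.sInf_mem hne
  exact ⟨List.ofFn f, by simpa [List.mem_ofFn] using hf, hfg, by simp [wordLength]⟩

theorem wordLength_prod_le (l : List G) (hl : ∀ x ∈ l, x ∈ S) :
    wordLength S l.prod ≤ l.length :=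
  Nat.sInf_le ⟨l.get, fun i => hl _ (l.get_mem i), by simp⟩

theorem wordLength_one : wordLength S (1 : G) = 0 :=
  Nat.le_zero.mp (wordLength_prod_le (S := S) [] (by simp))

theorem IsSymmGenSet.wordLength_mul_le (hS : IsSymmGenSet S) (x y : G) :
    wordLength S (x * y) ≤ wordLength S x + wordLength S y := by
  obtain ⟨l, hl, hlx, hn⟩ := hS.exists_list x
  obtain ⟨m, hm, hmy, hk⟩ := hS.exists_list y
  have := wordLength_prod_le (S := S) (l ++ m)
    (by simpa [or_imp, forall_and] using ⟨hl, hm⟩)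
  rw [List.prod_append, List.length_append] at this
  rwa [hlx, hmy, hn, hk] at this

theorem IsSymmGenSet.wordLength_inv_le (hS : IsSymmGenSet S) (x : G) :
    wordLength S x⁻¹ ≤ wordLength S x := by
  obtain ⟨l, hl, hlx, hn⟩ := hS.exists_list x
  have := wordLength_prod_le (S := S) (l.map fun x => x⁻¹).reverse
    (by
      intro y hy
      obtain ⟨z, hz, rfl⟩ : ∃ z ∈ l, z⁻¹ = y := by simpa using hy
      have := hl z hz
      rw [← hS.2.1]
      simpa using this)
  rw [← List.prod_inv_reverse, hlx] at this
  simpa [hn] using this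

theorem IsSymmGenSet.wordLength_inv (hS : IsSymmGenSet S) (x : G) :
    wordLength S x⁻¹ = wordLength S x :=
  le_antisymm (hS.wordLength_inv_le x) (by simpa using hS.wordLength_inv_le x⁻¹)

theorem IsSymmGenSet.finite_wordLength_le (hS : IsSymmGenSet S) (n : ℕ) :
    {g : G | wordLength S g ≤ n}.Finite := by
  have : Finite S := hS.1
  refine ((List.finite_length_le S n).image fun l => (l.map Subtype.val).prod).subset ?_
  intro g hg
  obtain ⟨l, hl, hlg, hn⟩ := hS.exists_list g
  refine ⟨l.attachWith (· ∈ S) hl, ?_, by simpa using hlg⟩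
  have : l.length ≤ n := hn.trans_le hg
  simpa using this

theorem IsSymmGenSet.finite_wordLength_le_real (hS : IsSymmGenSet S) (r : ℝ) :
    {g : G | (wordLength S g : ℝ) ≤ r}.Finite :=
  (hS.finite_wordLength_le ⌊r⌋₊).subset fun _ hg => Nat.le_floor hg

theorem wordDist_self (x : G) : wordDist S x x = 0 := by
  simp [wordDist, wordLength_one]

theorem wordDist_one_left (x : G) : wordDist S 1 x = wordLength S x := by
  simp [wordDist]

theorem wordDist_mul_left (g x y : G) : wordDist S (g * x) (g * y) = wordDist S x y := by
  simp [wordDist, mul_assoc]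

theorem gromovProd_mul_left (g x y w : G) :
    gromovProd S (g * x) (g * y) (g * w) = gromovProd S x y w := by
  simp [gromovProd, wordDist_mul_left]

theorem IsSymmGenSet.wordDist_comm (hS : IsSymmGenSet S) (x y : G) :
    wordDist S x y = wordDist S y x := by
  rw [wordDist, wordDist, ← hS.wordLength_inv]; simp

theorem IsSymmGenSet.wordDist_triangle (hS : IsSymmGenSet S) (x y z : G) :
    wordDist S x z ≤ wordDist S x y + wordDist S y z := by
  have := hS.wordLength_mul_le (x⁻¹ * y) (y⁻¹ * z)
  simpa [wordDist, mul_assoc] using this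

theorem IsSymmGenSet.wordDist_triangle_real (hS : IsSymmGenSet S) (x y z : G) :
    (wordDist S x z : ℝ) ≤ wordDist S x y + wordDist S y z := by
  exact_mod_cast hS.wordDist_triangle x y z

theorem wordDist_mul_right (x w : G) :
    wordDist S x (x * w) = wordLength S w := by
  simp [wordDist]

theorem IsSymmGenSet.gromovProd_comm (hS : IsSymmGenSet S) (x y w : G) :
    gromovProd S x y w = gromovProd S y x w := by
  simp only [gromovProd, hS.wordDist_comm x y]; ring

theorem IsSymmGenSet.exists_isGeodesic (hS : IsSymmGenSet S) (u v : G) :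
    ∃ p : ℕ → G, IsGeodesic S u v p := by
  obtain ⟨l, hl, hlg, hn⟩ := hS.exists_list (u⁻¹ * v)
  have hstep : ∀ i j, i ≤ j →
      wordDist S (u * (l.take i).prod) (u * (l.take j).prod) ≤ j - i := by
    intro i j hij
    have h1 : (l.take j).prod = (l.take i).prod * ((l.drop i).take (j - i)).prod := by
      rw [← List.prod_append]
      congr 1
      rw [← List.take_add]
      congr 1
      omega
    rw [wordDist_mul_left, h1, wordDist_mul_right]
    refine (wordLength_prod_le _ ?_).trans (by simp)
    intro x hx
    exact hl x (List.mem_of_mem_drop (List.mem_of_mem_take hx))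
  have hend : u * (l.take (wordDist S u v)).prod = v := by
    have : wordDist S u v = l.length := hn.symm
    rw [this, List.take_length, hlg]
    group
  refine ⟨fun i => u * (l.take i).prod, by simp, hend, fun i j hij hj => ?_⟩
  refine le_antisymm (hstep i j hij) ?_
  change j - i ≤ wordDist S (u * (l.take i).prod) (u * (l.take j).prod)
  have h1 := hstep 0 i (Nat.zero_le i)
  have h2 := hstep j _ hj
  rw [hend] at h2
  simp only [List.take_zero, List.prod_nil, mul_one] at h1
  have h3 := hS.wordDist_triangle u (u * (l.take i).prod) v
  have h4 := hS.wordDist_triangle (u * (l.take i).prod) (u * (l.take j).prod) v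
  omega

theorem IsGeodesic.wordDist_left {u v : G} {p : ℕ → G} (hp : IsGeodesic S u v p) {i : ℕ}
    (hi : i ≤ wordDist S u v) : (wordDist S u (p i) : ℝ) = i := by
  have := hp.2.2 0 i (Nat.zero_le i) hi
  rw [hp.1] at this
  rw [this]; simp

theorem IsGeodesic.wordDist_right {u v : G} {p : ℕ → G} (hp : IsGeodesic S u v p) {i : ℕ}
    (hi : i ≤ wordDist S u v) : (wordDist S (p i) v : ℝ) = wordDist S u v - i := by
  have := hp.2.2 i _ hi le_rfl
  rw [hp.2.1] at this
  rw [this, Nat.cast_sub hi]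

theorem IsSymmGenSet.gromovProd_nonneg (hS : IsSymmGenSet S) (x y w : G) :
    0 ≤ gromovProd S x y w := by
  have h := hS.wordDist_triangle_real x w y
  rw [hS.wordDist_comm x w] at h
  unfold gromovProd
  linarith

theorem IsSymmGenSet.gromovProd_le_left (hS : IsSymmGenSet S) (x y w : G) :
    gromovProd S x y w ≤ wordDist S w x := by
  have h := hS.wordDist_triangle_real w x y
  unfold gromovProd
  linarith

theorem IsSymmGenSet.gromovProd_le_right (hS : IsSymmGenSet S) (x y w : G) :
    gromovProd S x y w ≤ wordDist S w y := by
  rw [hS.gromovProd_comm]; exact hS.gromovProd_le_left y x w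

/-- The two Gromov products based at the ends of `[x, w]` add up to its length. -/
theorem IsSymmGenSet.gromovProd_add_gromovProd (hS : IsSymmGenSet S) (x y w : G) :
    gromovProd S x y w + gromovProd S w y x = wordDist S w x := by
  unfold gromovProd
  rw [hS.wordDist_comm x w]
  ring

theorem gromovProd_self_left (x y : G) : gromovProd S x y x = 0 := by
  simp [gromovProd, wordDist_self]

theorem gromovProd_same (x w : G) : gromovProd S x x w = wordDist S w x := by
  simp [gromovProd, wordDist_self]

theorem IsGeodesic.gromovProd_eq_zero (hS : IsSymmGenSet S) {u v : G} {p : ℕ → G}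
    (hp : IsGeodesic S u v p) {i : ℕ} (hi : i ≤ wordDist S u v) :
    gromovProd S u v (p i) = 0 := by
  have h1 := hp.wordDist_left hi
  have h2 := hp.wordDist_right hi
  unfold gromovProd
  rw [hS.wordDist_comm (p i) u, h1, h2]
  ring

/-- Gromov's four-point form of hyperbolicity. -/
def FourPoint (S : Set G) (κ : ℝ) : Prop :=
  ∀ x y z w : G, min (gromovProd S x y w) (gromovProd S y z w) ≤ gromovProd S x z w + κ

theorem ThinTriangles.fourPoint (hS : IsSymmGenSet S) {δ : ℝ} (h : ThinTriangles S δ) :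
    FourPoint S (δ + 1) := by
  intro x y z w
  obtain ⟨p, hp⟩ := hS.exists_isGeodesic w x
  obtain ⟨q, hq⟩ := hS.exists_isGeodesic w y
  obtain ⟨r, hr⟩ := hS.exists_isGeodesic w z
  set m := min (gromovProd S x y w) (gromovProd S y z w) with hm
  have hm0 : 0 ≤ m := le_min (hS.gromovProd_nonneg _ _ _) (hS.gromovProd_nonneg _ _ _)
  have hi : (⌊m⌋₊ : ℝ) ≤ m := Nat.floor_le hm0
  have hlt : m < ⌊m⌋₊ + 1 := Nat.lt_floor_add_one m
  have h1 := h w x y p q hp hq ⌊m⌋₊ (hi.trans (min_le_left _ _))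
  have h2 := h w y z q r hq hr ⌊m⌋₊ (hi.trans (min_le_right _ _))
  have hx : ⌊m⌋₊ ≤ wordDist S w x := by
    exact_mod_cast hi.trans ((min_le_left _ _).trans (hS.gromovProd_le_left _ _ _))
  have hz : ⌊m⌋₊ ≤ wordDist S w z := by
    exact_mod_cast hi.trans ((min_le_right _ _).trans (hS.gromovProd_le_right _ _ _))
  have hpx := hp.wordDist_right hx
  have hrz := hr.wordDist_right hz
  rw [hS.wordDist_comm] at hpx
  have t1 := hS.wordDist_triangle_real x (p ⌊m⌋₊) z
  have t2 := hS.wordDist_triangle_real (p ⌊m⌋₊) (q ⌊m⌋₊) z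
  have t3 := hS.wordDist_triangle_real (q ⌊m⌋₊) (r ⌊m⌋₊) z
  unfold gromovProd
  linarith

theorem FourPoint.le_or_le {κ : ℝ} (h : FourPoint S κ) {x z w : G} (y : G) {c : ℝ}
    (hc : gromovProd S x z w ≤ c) :
    gromovProd S x y w ≤ c + κ ∨ gromovProd S y z w ≤ c + κ :=
  min_le_iff.mp ((h x y z w).trans (by linarith))

/-- Quasiconvexity in terms of Gromov products: the distance from `p` to `Q` is bounded by
the Gromov product at `p` of any two points of `Q`, up to an additive constant. -/
def GromovQuasiconvex (S : Set G) (R : ℝ) (Q : Set G) : Prop :=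
  ∀ a ∈ Q, ∀ b ∈ Q, ∀ p : G, ∃ q ∈ Q, (wordDist S p q : ℝ) ≤ gromovProd S a b p + R

theorem IsQuasiconvex.gromovQuasiconvex (hS : IsSymmGenSet S) {δ ε : ℝ}
    (h : ThinTriangles S δ) {Q : Set G} (hQ : IsQuasiconvex S ε Q) :
    GromovQuasiconvex S (δ + 1 + ε) Q := by
  intro a ha b hb x
  obtain ⟨p, hp⟩ := hS.exists_isGeodesic a b
  obtain ⟨q, hq⟩ := hS.exists_isGeodesic a x
  set m := gromovProd S b x a with hm
  have hi : (⌊m⌋₊ : ℝ) ≤ m := Nat.floor_le (hS.gromovProd_nonneg _ _ _)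
  have hlt : m < ⌊m⌋₊ + 1 := Nat.lt_floor_add_one m
  have h1 := h a b x p q hp hq ⌊m⌋₊ hi
  have hib : ⌊m⌋₊ ≤ wordDist S a b := by
    exact_mod_cast hi.trans (hS.gromovProd_le_left _ _ _)
  have hix : ⌊m⌋₊ ≤ wordDist S a x := by
    exact_mod_cast hi.trans (hS.gromovProd_le_right _ _ _)
  obtain ⟨c, hc, hpc⟩ := hQ a ha b hb p hp _ hib
  refine ⟨c, hc, ?_⟩
  have hqx := hq.wordDist_right hix
  rw [hS.wordDist_comm] at hqx h1
  have t1 := hS.wordDist_triangle_real x (q ⌊m⌋₊) c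
  have t2 := hS.wordDist_triangle_real (q ⌊m⌋₊) (p ⌊m⌋₊) c
  have hsum := hS.gromovProd_add_gromovProd x b a
  rw [hS.gromovProd_comm x b a] at hsum
  linarith

theorem GromovQuasiconvex.isQuasiconvex (hS : IsSymmGenSet S) {R : ℝ} {Q : Set G}
    (hQ : GromovQuasiconvex S R Q) : ∃ ε : ℝ, 0 ≤ ε ∧ IsQuasiconvex S ε Q := by
  refine ⟨max R 0, le_max_right _ _, fun u hu v hv p hp i hi => ?_⟩
  obtain ⟨q, hq, hpq⟩ := hQ u hu v hv (p i)
  rw [hp.gromovProd_eq_zero hS hi] at hpq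
  exact ⟨q, hq, hpq.trans (by simp)⟩

end WordMetric

section Subgroups

variable {G : Type*} [Group G] {S : Set G}

theorem GromovQuasiconvex.conj (hS : IsSymmGenSet S) {R : ℝ} {H : Subgroup G}
    (hH : GromovQuasiconvex S R (H : Set G)) (g : G) :
    ∃ R', GromovQuasiconvex S R' ((H.map (MulAut.conj g).toMonoidHom : Subgroup G) : Set G) := by
  refine ⟨R + 3 * wordLength S g, ?_⟩
  rintro _ ⟨a, ha, rfl⟩ _ ⟨b, hb, rfl⟩ p
  obtain ⟨q, hq, hpq⟩ := hH a ha b hb (g⁻¹ * p)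
  refine ⟨g * q * g⁻¹, ⟨q, hq, by simp⟩, ?_⟩
  have hd : ∀ x : G, (wordDist S x (x * g⁻¹) : ℝ) = wordLength S g := fun x => by
    rw [wordDist_mul_right, hS.wordLength_inv]
  rw [← gromovProd_mul_left g, ← wordDist_mul_left g, mul_inv_cancel_left] at hpq
  simp only [MulEquiv.toMonoidHom_eq_coe, MonoidHom.coe_coe, MulAut.conj_apply]
  have h1 := hS.wordDist_triangle_real p (g * q) (g * q * g⁻¹)
  have h2 := hS.wordDist_triangle_real p (g * a * g⁻¹) (g * a)
  have h3 := hS.wordDist_triangle_real p (g * b * g⁻¹) (g * b)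
  have h4 := hS.wordDist_triangle_real (g * a * g⁻¹) (g * a) (g * b * g⁻¹)
  have h5 := hS.wordDist_triangle_real (g * a) (g * b) (g * b * g⁻¹)
  rw [hS.wordDist_comm (g * a * g⁻¹) (g * a)] at h2 h4
  rw [hS.wordDist_comm (g * b * g⁻¹) (g * b)] at h3
  rw [hd] at h1 h2 h3 h4 h5
  unfold gromovProd at hpq ⊢
  linarith

/-- A point close to two subgroups is close to their intersection. -/
theorem IsSymmGenSet.exists_near_inf (hS : IsSymmGenSet S) (H K : Subgroup G) (r : ℝ) :
    ∃ R : ℝ, ∀ p h k : G, h ∈ H → k ∈ K → (wordDist S p h : ℝ) ≤ r →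
      (wordDist S p k : ℝ) ≤ r → ∃ l ∈ H ⊓ K, (wordDist S p l : ℝ) ≤ R := by
  have hw : ∀ w : G, ∃ ρ : ℝ, ∀ h ∈ H, h * w ∈ K → ∃ l ∈ H ⊓ K, (wordDist S h l : ℝ) ≤ ρ := by
    intro w
    by_cases hex : ∃ h₀ ∈ H, h₀ * w ∈ K
    · obtain ⟨h₀, hh₀, hk₀⟩ := hex
      refine ⟨wordLength S h₀, fun h hh hk => ⟨h * h₀⁻¹, ⟨?_, ?_⟩, ?_⟩⟩
      · exact H.mul_mem hh (H.inv_mem hh₀)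
      · have := K.mul_mem hk (K.inv_mem hk₀)
        simpa [mul_assoc] using this
      · rw [wordDist_mul_right, hS.wordLength_inv]
    · exact ⟨0, fun h hh hk => absurd ⟨h, hh, hk⟩ hex⟩
  choose ρ hρ using hw
  obtain ⟨B, hB⟩ := ((hS.finite_wordLength_le_real (2 * r)).image ρ).bddAbove
  refine ⟨r + B, fun p h k hh hk hph hpk => ?_⟩
  have hhk : (wordLength S (h⁻¹ * k) : ℝ) ≤ 2 * r := by
    have := hS.wordDist_triangle_real h p k
    rw [hS.wordDist_comm h p] at this
    change (wordDist S h k : ℝ) ≤ _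
    linarith
  obtain ⟨l, hl, hhl⟩ := hρ (h⁻¹ * k) h hh (by simpa using hk)
  have hb : ρ (h⁻¹ * k) ≤ B := hB ⟨_, hhk, rfl⟩
  exact ⟨l, hl, by linarith [hS.wordDist_triangle_real p h l]⟩

theorem GromovQuasiconvex.inf (hS : IsSymmGenSet S) {R₁ R₂ : ℝ} {H K : Subgroup G}
    (hH : GromovQuasiconvex S R₁ (H : Set G)) (hK : GromovQuasiconvex S R₂ (K : Set G)) :
    ∃ ε : ℝ, 0 ≤ ε ∧ IsQuasiconvex S ε ((H ⊓ K : Subgroup G) : Set G) := by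
  obtain ⟨R, hR⟩ := hS.exists_near_inf H K (max R₁ R₂)
  refine ⟨max R 0, le_max_right _ _, fun u hu v hv p hp i hi => ?_⟩
  obtain ⟨h, hh, hph⟩ := hH u hu.1 v hv.1 (p i)
  obtain ⟨k, hk, hpk⟩ := hK u hu.2 v hv.2 (p i)
  rw [hp.gromovProd_eq_zero hS hi, zero_add] at hph hpk
  obtain ⟨l, hl, hpl⟩ := hR (p i) h k hh hk (hph.trans (le_max_left _ _))
    (hpk.trans (le_max_right _ _))
  exact ⟨l, hl, hpl.trans (le_max_left _ _)⟩

/-- `u` has minimal length in its left coset `uL`. -/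
def IsCosetMin (S : Set G) (L : Subgroup G) (u : G) : Prop :=
  ∀ l ∈ L, wordLength S u ≤ wordLength S (u * l)

theorem exists_isCosetMin (S : Set G) (L : Subgroup G) (u : G) :
    ∃ l ∈ L, IsCosetMin S L (u * l) := by
  obtain ⟨l, hl, hmin⟩ := (measure fun l : G => wordLength S (u * l)).wf.has_min (L : Set G)
    ⟨1, L.one_mem⟩
  refine ⟨l, hl, fun l' hl' => ?_⟩
  have := hmin (l * l') (L.mul_mem hl hl')
  rw [mul_assoc]
  exact not_lt.mp this

/-- A shortest representative of a coset of `H ⊓ K` in `H` makes a bounded turn with `K`. -/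
theorem exists_gromovProd_le_of_isCosetMin (hS : IsSymmGenSet S) {κ R₁ R₂ : ℝ} (hκ : 0 ≤ κ)
    (h4 : FourPoint S κ) {H K : Subgroup G} (hH : GromovQuasiconvex S R₁ (H : Set G))
    (hK : GromovQuasiconvex S R₂ (K : Set G)) :
    ∃ c : ℝ, ∀ u ∈ H, ∀ k ∈ K, IsCosetMin S (H ⊓ K) u → gromovProd S u⁻¹ k 1 ≤ c := by
  obtain ⟨R, hR⟩ := hS.exists_near_inf H K (max R₁ R₂ + κ)
  refine ⟨R + 1, fun u hu k hk hmin => ?_⟩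
  set t := gromovProd S u⁻¹ k 1 with ht
  have hi : (⌊t⌋₊ : ℝ) ≤ t := Nat.floor_le (hS.gromovProd_nonneg _ _ _)
  have hlt : t < ⌊t⌋₊ + 1 := Nat.lt_floor_add_one t
  obtain ⟨p, hp⟩ := hS.exists_isGeodesic 1 u⁻¹
  have hiu : ⌊t⌋₊ ≤ wordDist S 1 u⁻¹ := by
    exact_mod_cast hi.trans (hS.gromovProd_le_left _ _ _)
  have hl := hp.wordDist_left hiu
  have hr := hp.wordDist_right hiu
  have h0 := hp.gromovProd_eq_zero hS hiu
  generalize p ⌊t⌋₊ = x at hl hr h0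
  have hxk : gromovProd S 1 k x ≤ κ := by
    have h1 := h4 x u⁻¹ k 1
    have h2 := hS.gromovProd_add_gromovProd x k 1
    have h3 := hS.gromovProd_add_gromovProd x u⁻¹ 1
    rw [← ht, min_eq_left (by linarith)] at h1
    linarith
  obtain ⟨h, hh, hxh⟩ := hH 1 H.one_mem u⁻¹ (H.inv_mem hu) x
  obtain ⟨k', hk', hxk'⟩ := hK 1 K.one_mem k hk x
  obtain ⟨l, hlL, hxl⟩ := hR x h k' hh hk' (by linarith [le_max_left R₁ R₂])
    (by linarith [le_max_right R₁ R₂])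
  have hul : (wordDist S 1 u⁻¹ : ℝ) ≤ wordDist S u⁻¹ l := by
    rw [wordDist_one_left, hS.wordLength_inv, wordDist, inv_inv]
    exact_mod_cast hmin l hlL
  have := hS.wordDist_triangle_real u⁻¹ x l
  rw [hS.wordDist_comm u⁻¹ x] at this
  linarith

end Subgroups

section AlternatingWords

variable {G : Type*} [Group G] {S : Set G}

/-- `AltWord S A A' L b y` says that `y` is a product of syllables taken alternately from the
subgroups `A' false` and `A' true`, followed by an element of `A true`, where the first syllable
comes from index `b`, and every syllable except the last lies outside `L` and has minimal length
in its left coset of `L`. -/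
inductive AltWord (S : Set G) (A A' : Bool → Subgroup G) (L : Subgroup G) : Bool → G → Prop
  | last {k : G} : k ∈ A true → AltWord S A A' L true k
  | cons {b : Bool} {u y : G} : u ∈ A' b → u ∉ L → IsCosetMin S L u →
      AltWord S A A' L (!b) y → AltWord S A A' L b (u * y)

variable {A A' : Bool → Subgroup G} {L : Subgroup G}

theorem AltWord.mul_left_mem (hLA : L ≤ A true) (hLA' : ∀ b, L ≤ A' b) {b : Bool} {y : G}
    (h : AltWord S A A' L b y) : ∀ l ∈ L, AltWord S A A' L b (l * y) := by
  induction h with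
  | last hk => exact fun l hl => .last ((A true).mul_mem (hLA hl) hk)
  | @cons b u y hu huL _ _ ih =>
    intro l hl
    obtain ⟨l', hl', hmin⟩ := exists_isCosetMin S L (l * u)
    have : l * (u * y) = l * u * l' * (l'⁻¹ * y) := by group
    rw [this]
    refine .cons ((A' b).mul_mem ((A' b).mul_mem (hLA' b hl) hu) (hLA' b hl')) ?_ hmin
      (ih _ (L.inv_mem hl'))
    rwa [L.mul_mem_cancel_right hl', L.mul_mem_cancel_left hl]

theorem AltWord.mul_left_of_notMem (hLA : L ≤ A true) (hLA' : ∀ b, L ≤ A' b) {b : Bool}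
    {u y : G} (hu : u ∈ A' b) (huL : u ∉ L) (h : AltWord S A A' L (!b) y) :
    AltWord S A A' L b (u * y) := by
  obtain ⟨l, hl, hmin⟩ := exists_isCosetMin S L u
  have : u * y = u * l * (l⁻¹ * y) := by group
  rw [this]
  exact .cons ((A' b).mul_mem hu (hLA' b hl)) (by rwa [L.mul_mem_cancel_right hl]) hmin
    (h.mul_left_mem hLA hLA' _ (L.inv_mem hl))

theorem AltWord.exists_mul_left (hLA : L ≤ A true) (hLA' : ∀ b, L ≤ A' b)
    (hA' : ∀ b, A' b ≤ A b) {b τ : Bool} {a y : G} (ha : a ∈ A' τ)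
    (h : AltWord S A A' L b y) : ∃ b', AltWord S A A' L b' (a * y) := by
  by_cases haL : a ∈ L
  · exact ⟨b, h.mul_left_mem hLA hLA' a haL⟩
  by_cases hb : τ = b
  · subst hb
    cases h with
    | last hk => exact ⟨true, .last ((A true).mul_mem (hA' _ ha) hk)⟩
    | @cons _ u y hu huL hmin hy =>
      rw [← mul_assoc]
      by_cases hauL : a * u ∈ L
      · exact ⟨_, hy.mul_left_mem hLA hLA' _ hauL⟩
      · exact ⟨_, hy.mul_left_of_notMem hLA hLA' ((A' τ).mul_mem ha hu) hauL⟩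
  · obtain rfl : b = !τ := by cases b <;> cases τ <;> simp_all
    exact ⟨τ, h.mul_left_of_notMem hLA hLA' ha haL⟩

theorem exists_altWord (hLA : L ≤ A true) (hLA' : ∀ b, L ≤ A' b) (hA' : ∀ b, A' b ≤ A b)
    {m k : G} (hm : m ∈ A' false ⊔ A' true) (hk : k ∈ A true) :
    ∃ b, AltWord S A A' L b (m * k) := by
  rw [Subgroup.sup_eq_closure] at hm
  induction hm using Subgroup.closure_induction_left with
  | one => exact ⟨true, by rw [one_mul]; exact .last hk⟩
  | mul_left x hx y _ ih =>
    obtain ⟨b, hb⟩ := ih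
    rw [mul_assoc]
    rcases hx with hx | hx <;> exact hb.exists_mul_left hLA hLA' hA' hx
  | inv_mul_cancel x hx y _ ih =>
    obtain ⟨b, hb⟩ := ih
    rw [mul_assoc]
    rcases hx with hx | hx <;> exact hb.exists_mul_left hLA hLA' hA' (inv_mem hx)

theorem AltWord.exists_mul_eq {b : Bool} {y : G} (h : AltWord S A A' L b y) :
    ∃ m ∈ A' false ⊔ A' true, ∃ k ∈ A true, y = m * k := by
  induction h with
  | last hk => exact ⟨1, one_mem _, _, hk, by simp⟩
  | @cons b u y hu _ _ _ ih =>
    obtain ⟨m, hm, k, hk, rfl⟩ := ih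
    refine ⟨u * m, mul_mem ?_ hm, k, hk, by group⟩
    cases b
    · exact Subgroup.mem_sup_left hu
    · exact Subgroup.mem_sup_right hu

/-- Every element of `(A false) M (A true)`, where `M` is generated by the `A' b`, is an
alternating word preceded by an element of `A false`. -/
theorem exists_mul_altWord (hLA : ∀ b, L ≤ A b) (hLA' : ∀ b, L ≤ A' b)
    (hA' : ∀ b, A' b ≤ A b) {h m k : G} (hh : h ∈ A false) (hm : m ∈ A' false ⊔ A' true)
    (hk : k ∈ A true) : ∃ u ∈ A false, IsCosetMin S L u ∧ ∃ y, AltWord S A A' L true y ∧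
      h * m * k = u * y := by
  obtain ⟨u, hu, y, hy, he⟩ : ∃ u ∈ A false, ∃ y, AltWord S A A' L true y ∧
      h * m * k = u * y := by
    obtain ⟨b, hb⟩ := exists_altWord (S := S) (hLA true) hLA' hA' hm hk
    rw [mul_assoc]
    generalize m * k = x at hb
    cases b with
    | true => exact ⟨h, hh, x, hb, rfl⟩
    | false =>
      cases hb with
      | @cons _ u y hu _ _ hy =>
        exact ⟨h * u, mul_mem hh (hA' _ hu), y, hy, (mul_assoc _ _ _).symm⟩
  obtain ⟨l, hl, hmin⟩ := exists_isCosetMin S L u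
  exact ⟨u * l, mul_mem hu (hLA _ hl), hmin, l⁻¹ * y,
    hy.mul_left_mem (hLA true) hLA' _ (inv_mem hl), by rw [he]; group⟩

variable {κ c C : ℝ}

/-- A path labelled by an alternating word with long syllables makes only bounded turns. -/
theorem AltWord.gromovProd_le (hS : IsSymmGenSet S) (h4 : FourPoint S κ) (hκ : 0 ≤ κ)
    (hA' : ∀ b, A' b ≤ A b) (hC : ∀ b, ∀ u ∈ A' b, u ∉ L → C < wordLength S u)
    (hCc : 2 * c + 5 * κ ≤ C)
    (hc : ∀ b, ∀ u ∈ A (!b), ∀ v ∈ A b, IsCosetMin S L u → gromovProd S u⁻¹ v 1 ≤ c)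
    {b : Bool} {y : G} (h : AltWord S A A' L b y) :
    ∀ u ∈ A (!b), IsCosetMin S L u → gromovProd S u⁻¹ y 1 ≤ c + κ := by
  induction h with
  | last hk => exact fun u hu hmin => by linarith [hc true u hu _ hk hmin]
  | @cons b v y hv hvL hvmin _ ih =>
    intro u hu hmin
    have h1 := ih v (by simpa using hA' b hv) hvmin
    rw [← gromovProd_mul_left v, mul_inv_cancel, mul_one] at h1
    have h2 := hC b v hv hvL
    have h3 := hS.gromovProd_add_gromovProd v (v * y) 1
    rw [wordDist_one_left] at h3
    have h5 := hS.gromovProd_comm v (v * y) 1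
    rcases h4.le_or_le (v * y) (hc b u hu v (hA' b hv) hmin) with h | h <;> linarith

/-- The geodesic from `o` to `y` stays close to the path labelled by an alternating word from
`1` to `y`, once it has passed `1`. -/
theorem AltWord.near_or_le (hS : IsSymmGenSet S) (h4 : FourPoint S κ) (hκ : 0 ≤ κ)
    (hA' : ∀ b, A' b ≤ A b) (hC : ∀ b, ∀ u ∈ A' b, u ∉ L → C < wordLength S u)
    (hCc : 2 * c + 5 * κ ≤ C)
    (hc : ∀ b, ∀ u ∈ A (!b), ∀ v ∈ A b, IsCosetMin S L u → gromovProd S u⁻¹ v 1 ≤ c)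
    {M : Subgroup G} (hM : ∀ b, A' b ≤ M) {R R' : ℝ}
    (hR : ∀ b, ∀ v ∈ A b, ∀ p, ∃ m ∈ M, (wordDist S p m : ℝ) ≤ gromovProd S 1 v p + R)
    (hRR' : R + 2 * κ ≤ R') (hcR' : c + 5 * κ ≤ R') {b : Bool} {y : G}
    (h : AltWord S A A' L b y) :
    ∀ o p : G, gromovProd S o y 1 ≤ c + 2 * κ → gromovProd S o y p ≤ 0 →
      (∃ m ∈ M, (wordDist S p m : ℝ) ≤ R') ∨ gromovProd S o 1 p ≤ κ := by
  induction h with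
  | @last k hk =>
    intro o p _ hp
    rcases h4.le_or_le 1 hp with h | h
    · right; linarith
    · left
      obtain ⟨m, hm, hpm⟩ := hR true k hk p
      exact ⟨m, hm, by linarith⟩
  | @cons b u y hu huL humin hy ih =>
    intro o p ho hp
    have hlong := hC b u hu huL
    have hturn := hy.gromovProd_le hS h4 hκ hA' hC hCc hc u (by simpa using hA' b hu) humin
    rw [← gromovProd_mul_left u, mul_inv_cancel, mul_one] at hturn
    have hou : gromovProd S o (u * y) u ≤ c + 2 * κ := by
      have h1 := hS.gromovProd_add_gromovProd u (u * y) 1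
      have h2 := hS.gromovProd_add_gromovProd u o 1
      have h3 := hS.gromovProd_comm u (u * y) 1
      have h5 := hS.gromovProd_comm u o 1
      have h6 := hS.gromovProd_comm 1 o u
      rw [wordDist_one_left] at h1 h2
      have h7 : gromovProd S o u 1 ≤ c + 3 * κ := by
        rcases h4.le_or_le u ho with h | h <;> linarith
      rcases h4.le_or_le o hturn with h | h <;> linarith
    have key := ih (u⁻¹ * o) (u⁻¹ * p)
      (by rw [← gromovProd_mul_left u]; simpa using hou)
      (by rw [← gromovProd_mul_left u]; simpa using hp)
    rcases key with ⟨m, hm, hpm⟩ | key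
    · left
      refine ⟨u * m, mul_mem (hM b hu) hm, ?_⟩
      rwa [← wordDist_mul_left u, mul_inv_cancel_left] at hpm
    · rw [← gromovProd_mul_left u, mul_inv_cancel_left, mul_inv_cancel_left, mul_one] at key
      rcases h4.le_or_le 1 hp with h | h
      · right; linarith
      left
      rcases h4.le_or_le 1 key with h' | h'
      · refine ⟨1, one_mem M, ?_⟩
        have hsum : (wordDist S p 1 : ℝ) = gromovProd S o 1 p + gromovProd S 1 (u * y) p
            - gromovProd S o (u * y) p + gromovProd S o (u * y) 1 := by
          unfold gromovProd
          rw [hS.wordDist_comm o 1]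
          ring
        have := hS.gromovProd_nonneg o (u * y) p
        linarith
      · obtain ⟨m, hm, hpm⟩ := hR b u (hA' b hu) p
        exact ⟨m, hm, by linarith⟩

/-- A combination theorem: if the subgroups `A' b` have no short elements outside `L`, and
geodesics to points of `A b` stay close to the subgroup they generate, then that subgroup is
quasiconvex. -/
theorem isQuasiconvex_sup (hS : IsSymmGenSet S) (h4 : FourPoint S κ) (hκ : 0 ≤ κ)
    (hLA : L ≤ A true) (hLA' : ∀ b, L ≤ A' b)
    (hA' : ∀ b, A' b ≤ A b) (hC : ∀ b, ∀ u ∈ A' b, u ∉ L → C < wordLength S u)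
    (hCc : 2 * c + 5 * κ ≤ C) (hc0 : 0 ≤ c)
    (hc : ∀ b, ∀ u ∈ A (!b), ∀ v ∈ A b, IsCosetMin S L u → gromovProd S u⁻¹ v 1 ≤ c) {R : ℝ}
    (hR : ∀ b, ∀ v ∈ A b, ∀ p, ∃ m ∈ A' false ⊔ A' true,
      (wordDist S p m : ℝ) ≤ gromovProd S 1 v p + R) :
    ∃ ε : ℝ, 0 ≤ ε ∧ IsQuasiconvex S ε ((A' false ⊔ A' true : Subgroup G) : Set G) := by
  have hM : ∀ b, A' b ≤ A' false ⊔ A' true := by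
    rintro (_ | _)
    exacts [le_sup_left, le_sup_right]
  set M := A' false ⊔ A' true
  refine ⟨max (R + 2 * κ) (c + 5 * κ), le_max_of_le_right (by positivity),
    fun x hx z hz p hp i hi => ?_⟩
  obtain ⟨b, hb⟩ := exists_altWord (S := S) hLA hLA' hA' (mul_mem (inv_mem hx) hz)
    (one_mem (A true))
  rw [mul_one] at hb
  have h0 := hp.gromovProd_eq_zero hS hi
  rw [← gromovProd_mul_left x⁻¹, inv_mul_cancel] at h0
  have key := hb.near_or_le hS h4 hκ hA' hC hCc hc hM hR (le_max_left _ _) (le_max_right _ _)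
    1 (x⁻¹ * p i) (by rw [gromovProd_self_left]; positivity) h0.le
  rcases key with ⟨m, hm, hpm⟩ | key
  · refine ⟨x * m, mul_mem hx hm, ?_⟩
    rwa [← wordDist_mul_left x, mul_inv_cancel_left] at hpm
  · refine ⟨x, hx, ?_⟩
    rw [gromovProd_same, ← wordDist_mul_left x, mul_inv_cancel_left, mul_one] at key
    exact key.trans (le_max_of_le_right (by linarith))

end AlternatingWords

section Profinite

variable {G : Type*} [Group G]

/-- Closedness in the profinite topology, spelled out: a point all of whose neighbourhoods `gN`
meet `P` lies in `P`. -/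
def ProfiniteClosed (P : Set G) : Prop :=
  ∀ g : G, (∀ N : Subgroup G, N.Normal → N.FiniteIndex → ∃ n ∈ N, g * n ∈ P) → g ∈ P

theorem separableSubset_iff_profiniteClosed {P : Set G} :
    SeparableSubset G P ↔ ProfiniteClosed P := by
  let _ := profiniteTopology G
  change IsClosed P ↔ _
  rw [← isOpen_compl_iff]
  constructor
  · intro hP g hg
    have key : ∀ U : Set G, IsOpen U → ∀ x ∈ U, ∃ N : Subgroup G, N.Normal ∧ N.FiniteIndex ∧
        ∀ n ∈ N, x * n ∈ U := by
      intro U hU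
      induction hU with
      | basic U hU =>
        obtain ⟨y, N, hN, hNf, rfl⟩ := hU
        rintro _ ⟨z, hz, rfl⟩
        refine ⟨N, hN, hNf, fun n hn => ⟨z * n, mul_mem hz hn, ?_⟩⟩
        simp [mul_assoc]
      | univ => exact fun x _ => ⟨⊤, inferInstance, inferInstance, fun _ _ => trivial⟩
      | inter U V _ _ ihU ihV =>
        rintro x ⟨hxU, hxV⟩
        obtain ⟨N₁, hN₁, hf₁, h₁⟩ := ihU x hxU
        obtain ⟨N₂, hN₂, hf₂, h₂⟩ := ihV x hxV
        exact ⟨N₁ ⊓ N₂, inferInstance, inferInstance, fun n hn => ⟨h₁ n hn.1, h₂ n hn.2⟩⟩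
      | sUnion s _ ih =>
        rintro x ⟨U, hU, hxU⟩
        obtain ⟨N, hN, hf, h⟩ := ih U hU x hxU
        exact ⟨N, hN, hf, fun n hn => ⟨U, hU, h n hn⟩⟩
    by_contra hgP
    obtain ⟨N, hN, hf, h⟩ := key _ hP g hgP
    obtain ⟨n, hn, hgn⟩ := hg N hN hf
    exact h n hn hgn
  · intro hP
    rw [isOpen_iff_forall_mem_open]
    intro g hg
    have hg' : ¬ ∀ N : Subgroup G, N.Normal → N.FiniteIndex → ∃ n ∈ N, g * n ∈ P :=
      fun h => hg (hP g h)
    push Not at hg'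
    obtain ⟨N, hN, hf, h⟩ := hg'
    refine ⟨g • (N : Set G), ?_, TopologicalSpace.isOpen_generateFrom_of_mem ⟨g, N, hN, hf, rfl⟩,
      ⟨1, one_mem N, by simp⟩⟩
    rintro _ ⟨n, hn, rfl⟩
    exact h n hn

theorem ProfiniteClosed.biUnion {ι : Type*} {I : Set ι} (hI : I.Finite) {P : ι → Set G}
    (h : ∀ i ∈ I, ProfiniteClosed (P i)) : ProfiniteClosed (⋃ i ∈ I, P i) := by
  let _ := profiniteTopology G
  refine separableSubset_iff_profiniteClosed.mp (hI.isClosed_biUnion fun i hi => ?_)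
  exact separableSubset_iff_profiniteClosed.mpr (h i hi)

theorem ProfiniteClosed.mul_singleton {P : Set G} (h : ProfiniteClosed P) (w : G) :
    ProfiniteClosed (P * {w}) := by
  intro g hg
  have : g * w⁻¹ ∈ P := by
    refine h _ fun N hN hf => ?_
    obtain ⟨n, hn, hgn⟩ := hg N hN hf
    refine ⟨w * n * w⁻¹, hN.conj_mem n hn w, ?_⟩
    have hgn' : g * n * w⁻¹ ∈ P := by simpa using hgn
    convert hgn' using 1
    group
  exact ⟨g * w⁻¹, this, w, rfl, by simp⟩

/-- Finitely many points can be separated from closed sets by a single finite index normal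
subgroup. -/
theorem ProfiniteClosed.exists_normal {ι : Type*} {I : Set ι} (hI : I.Finite) {P : ι → Set G}
    {x : ι → G} (h : ∀ i ∈ I, ProfiniteClosed (P i)) (hx : ∀ i ∈ I, x i ∉ P i) :
    ∃ N : Subgroup G, N.Normal ∧ N.FiniteIndex ∧ ∀ i ∈ I, ∀ n ∈ N, x i * n ∉ P i := by
  induction I, hI using Set.Finite.induction_on with
  | empty => exact ⟨⊤, inferInstance, inferInstance, by simp⟩
  | @insert a I _ _ ih =>
    obtain ⟨N₁, hN₁, hf₁, h₁⟩ := ih (fun i hi => h i (.inr hi)) (fun i hi => hx i (.inr hi))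
    have h₂ : ¬ ∀ N : Subgroup G, N.Normal → N.FiniteIndex → ∃ n ∈ N, x a * n ∈ P a :=
      fun h' => hx a (.inl rfl) (h a (.inl rfl) _ h')
    push Not at h₂
    obtain ⟨N₂, hN₂, hf₂, h₂⟩ := h₂
    refine ⟨N₁ ⊓ N₂, inferInstance, inferInstance, ?_⟩
    rintro i (rfl | hi) n hn
    · exact h₂ n hn.2
    · exact h₁ i hi n hn.1

theorem Subgroup.exists_finite_representatives (A N : Subgroup G) [N.FiniteIndex] :
    ∃ T : Set G, T.Finite ∧ T ⊆ A ∧ ∀ a ∈ A, ∃ t ∈ T, t⁻¹ * a ∈ N := by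
  have hq : ∀ q : G ⧸ N, ∃ t ∈ A, ∀ a ∈ A, (a : G ⧸ N) = q → t⁻¹ * a ∈ N := by
    intro q
    by_cases h : ∃ t ∈ A, (t : G ⧸ N) = q
    · obtain ⟨t, ht, rfl⟩ := h
      exact ⟨t, ht, fun a _ he => QuotientGroup.eq.mp he.symm⟩
    · exact ⟨1, one_mem A, fun a ha he => absurd ⟨a, ha, he⟩ h⟩
  choose t ht hta using hq
  exact ⟨Set.range t, Set.finite_range t, by rintro _ ⟨q, rfl⟩; exact ht q,
    fun a ha => ⟨t a, ⟨_, rfl⟩, hta _ a ha rfl⟩⟩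

theorem Subgroup.map_conj_mul_singleton (K : Subgroup G) (w : G) :
    ((K.map (MulAut.conj w).toMonoidHom : Subgroup G) : Set G) * {w} = {w} * (K : Set G) := by
  ext x
  simp only [Set.mul_singleton, Set.singleton_mul, Subgroup.coe_map, Set.image_image]
  simp

/-- The product set of a list of subgroups. -/
def subgroupProd (l : List (Subgroup G)) : Set G :=
  (l.map fun H : Subgroup G => (H : Set G)).prod

theorem subgroupProd_nil : subgroupProd ([] : List (Subgroup G)) = {1} := rfl

theorem subgroupProd_cons (H : Subgroup G) (l : List (Subgroup G)) :
    subgroupProd (H :: l) = (H : Set G) * subgroupProd l := by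
  simp [subgroupProd]

theorem subgroupProd_concat (l : List (Subgroup G)) (H : Subgroup G) :
    subgroupProd (l ++ [H]) = subgroupProd l * (H : Set G) := by
  simp [subgroupProd]

end Profinite

section Products

variable {G : Type*} [Group G] {S : Set G}

/-- If the side `[1, f]` of the broken line spelled by `f ∈ G₁ ⋯ Gᵣ` passes near `f * h`, then
`f * h` is near an initial part `G₁ ⋯ Gₖ` of the product. -/
theorem exists_prefix_near (hS : IsSymmGenSet S) {κ : ℝ} (h4 : FourPoint S κ) (H : Subgroup G)
    (F : List (Subgroup G)) :
    (∀ A ∈ F, ∃ R, GromovQuasiconvex S R (A : Set G)) → ∀ c : ℝ, ∃ D : ℝ,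
      ∀ f ∈ subgroupProd F, ∀ h ∈ H, gromovProd S 1 f (f * h) ≤ c →
        ∃ F₁, F₁ <+: F ∧ ∃ w, (wordLength S w : ℝ) ≤ D ∧ f * h ∈ subgroupProd F₁ * {w} ∧
          subgroupProd F₁ * {w} ⊆ subgroupProd F * (H : Set G) := by
  induction F with
  | nil =>
    intro _ c
    refine ⟨c, fun f hf h hh hle => ⟨[], List.prefix_rfl, h, ?_, ?_, ?_⟩⟩
    · obtain rfl : f = 1 := hf
      rw [gromovProd_same, one_mul, hS.wordDist_comm, wordDist_one_left] at hle
      exact hle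
    · exact Set.mul_mem_mul hf rfl
    · exact Set.mul_subset_mul_left (by simpa using hh)
  | cons A F ih =>
    intro hF c
    obtain ⟨R, hR⟩ := hF A (by simp)
    obtain ⟨D, hD⟩ := ih (fun B hB => hF B (by simp [hB])) (c + κ)
    refine ⟨max D (c + κ + R), ?_⟩
    rw [subgroupProd_cons]
    rintro _ ⟨a, ha, f, hf, rfl⟩ h hh hle
    simp only at hle ⊢
    rcases h4.le_or_le a hle with hle | hle
    · obtain ⟨q, hq, hpq⟩ := hR 1 (one_mem A) a ha (a * f * h)
      refine ⟨[A], by simp, q⁻¹ * (a * f * h), le_max_of_le_right ?_, ?_, ?_⟩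
      · rw [hS.wordDist_comm, wordDist] at hpq
        linarith
      · exact ⟨q, by simpa [subgroupProd] using hq, _, rfl, by simp⟩
      · rintro _ ⟨b, hb, _, rfl, rfl⟩
        have hb' : b ∈ A := by simpa [subgroupProd] using hb
        exact ⟨b * q⁻¹ * a * f, ⟨b * q⁻¹ * a, mul_mem (mul_mem hb' (inv_mem hq)) ha, f, hf, rfl⟩,
          h, hh, by simp only; group⟩
    · rw [← gromovProd_mul_left a⁻¹, inv_mul_cancel, mul_assoc, inv_mul_cancel_left,
        inv_mul_cancel_left] at hle
      obtain ⟨F₁, hF₁, w, hw, hmem, hsub⟩ := hD f hf h hh hle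
      refine ⟨A :: F₁, by simpa using hF₁, w, le_max_of_le_left hw, ?_, ?_⟩
      · rw [subgroupProd_cons, mul_assoc, mul_assoc]
        exact Set.mul_mem_mul ha hmem
      · rw [subgroupProd_cons, mul_assoc, mul_assoc]
        exact Set.mul_subset_mul_left hsub

/-- The induction step: closedness of shorter products implies that of `F H K`. -/
theorem profiniteClosed_mul_mul (hS : IsSymmGenSet S) {δ : ℝ} (hδ : 0 ≤ δ)
    (hhyp : ThinTriangles S δ) (hGFERF : GFERF S) (F : List (Subgroup G)) (H K : Subgroup G)
    (hF : ∀ A ∈ F, ∃ R, GromovQuasiconvex S R (A : Set G)) {R₁ R₂ : ℝ}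
    (hH : GromovQuasiconvex S R₁ (H : Set G)) (hK : GromovQuasiconvex S R₂ (K : Set G))
    (IH : ∀ l : List (Subgroup G), l.length ≤ F.length + 1 →
      (∀ A ∈ l, ∃ R, GromovQuasiconvex S R (A : Set G)) → ProfiniteClosed (subgroupProd l)) :
    ProfiniteClosed (subgroupProd F * (H : Set G) * (K : Set G)) := by
  obtain ⟨κ, hκ, h4⟩ : ∃ κ : ℝ, 0 ≤ κ ∧ FourPoint S κ :=
    ⟨δ + 1, by linarith, hhyp.fourPoint hS⟩
  set L := H ⊓ K with hL
  have hLclosed : ProfiniteClosed (L : Set G) :=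
    separableSubset_iff_profiniteClosed.mp (hGFERF L (hH.inf hS hK))
  let A : Bool → Subgroup G := fun b => cond b K H
  have hLA : ∀ b, L ≤ A b := by
    rintro (_ | _)
    exacts [inf_le_left, inf_le_right]
  have hA : ∀ b, ∃ R, GromovQuasiconvex S R (A b : Set G) := by
    rintro (_ | _)
    exacts [⟨R₁, hH⟩, ⟨R₂, hK⟩]
  obtain ⟨c, hc0, hc⟩ : ∃ c : ℝ, 0 ≤ c ∧ ∀ b, ∀ u ∈ A (!b), ∀ v ∈ A b, IsCosetMin S L u →
      gromovProd S u⁻¹ v 1 ≤ c := by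
    obtain ⟨c₁, h₁⟩ := exists_gromovProd_le_of_isCosetMin hS hκ h4 hH hK
    obtain ⟨c₂, h₂⟩ := exists_gromovProd_le_of_isCosetMin hS hκ h4 hK hH
    rw [inf_comm] at h₂
    refine ⟨max (max c₁ c₂) 0, le_max_right _ _, ?_⟩
    rintro (_ | _) u hu v hv hmin
    · exact (h₂ u hu v hv hmin).trans (by simp)
    · exact (h₁ u hu v hv hmin).trans (by simp)
  have hconj : ∀ (F₁ : List (Subgroup G)) (B : Subgroup G) (w : G), F₁ <+: F →
      (∃ R, GromovQuasiconvex S R (B : Set G)) →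
      ProfiniteClosed (subgroupProd F₁ * {w} * (B : Set G)) := by
    rintro F₁ B w hF₁ ⟨R, hB⟩
    rw [mul_assoc, ← B.map_conj_mul_singleton, ← mul_assoc, ← subgroupProd_concat]
    refine (IH _ (by simpa using hF₁.length_le) ?_).mul_singleton w
    intro A' hA'
    rcases List.mem_append.mp hA' with h | h
    · exact hF A' (hF₁.subset h)
    · rw [List.mem_singleton.mp h]
      exact hB.conj hS w
  intro g hg
  by_contra hgP
  obtain ⟨D, hD⟩ := exists_prefix_near hS h4 H F hF (c + κ + κ)
  let D' := max D (c + κ + κ + wordLength S g)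
  let I : Set (List (Subgroup G) × G) := {x | x.1 <+: F ∧ (wordLength S x.2 : ℝ) ≤ D' ∧
    subgroupProd x.1 * {x.2} ⊆ subgroupProd F * (H : Set G)}
  have hI : I.Finite := by
    refine ((F.inits.finite_toSet).prod (hS.finite_wordLength_le_real D')).subset ?_
    rintro ⟨F₁, w⟩ ⟨h1, h2, -⟩
    exact ⟨(List.mem_inits _ _).mpr h1, h2⟩
  obtain ⟨N₁, hN₁, hf₁, hsep₁⟩ := ProfiniteClosed.exists_normal hI
    (P := fun x => subgroupProd x.1 * {x.2} * (K : Set G)) (x := fun _ => g)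
    (fun x hx => hconj x.1 K x.2 hx.1 ⟨R₂, hK⟩)
    (fun x hx hgx => hgP (Set.mul_subset_mul_right hx.2.2 hgx))
  let C := 2 * c + 5 * κ
  obtain ⟨N₂, hN₂, hf₂, hsep₂⟩ := ProfiniteClosed.exists_normal
    ((hS.finite_wordLength_le_real C).inter_of_left {u | u ∉ L})
    (P := fun _ => (L : Set G)) (x := id) (fun _ _ => hLclosed) (fun u hu => hu.2)
  set N := N₁ ⊓ N₂ with hN
  have hNn : N.Normal := inferInstance
  have hNf : N.FiniteIndex := inferInstance
  let A' : Bool → Subgroup G := fun b => L ⊔ A b ⊓ N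
  have hLA' : ∀ b, L ≤ A' b := fun b => le_sup_left
  have hA' : ∀ b, A' b ≤ A b := fun b => sup_le (hLA b) inf_le_left
  have hA'N : ∀ b, A' b ≤ L ⊔ N := fun b => sup_le_sup_left inf_le_right L
  have hC : ∀ b, ∀ u ∈ A' b, u ∉ L → C < wordLength S u := by
    intro b u hu huL
    by_contra! hlen
    obtain ⟨l, hl, n, hn, rfl⟩ := Subgroup.mem_sup_of_normal_right.mp (hA'N b hu)
    refine hsep₂ _ ⟨hlen, huL⟩ n⁻¹ (inv_mem hn.2) ?_
    simpa using hl
  have hM : ∀ b, A' b ≤ A' false ⊔ A' true := by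
    rintro (_ | _)
    exacts [le_sup_left, le_sup_right]
  have hMN : A' false ⊔ A' true ≤ L ⊔ N := sup_le (hA'N _) (hA'N _)
  choose T hTf hTA hT using fun b => (A b).exists_finite_representatives N
  obtain ⟨R, hR⟩ : ∃ R : ℝ, ∀ b, ∀ v ∈ A b, ∀ p, ∃ m ∈ A' false ⊔ A' true,
      (wordDist S p m : ℝ) ≤ gromovProd S 1 v p + R := by
    choose ρ hρ using hA
    choose B hB using fun b => ((hTf b).image fun t => (wordLength S t : ℝ)).bddAbove
    refine ⟨max (ρ false + B false) (ρ true + B true), fun b v hv p => ?_⟩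
    obtain ⟨q, hq, hpq⟩ := hρ b 1 (one_mem _) v hv p
    obtain ⟨t, ht, htq⟩ := hT b q⁻¹ (inv_mem hq)
    have hmem : t⁻¹ * q⁻¹ ∈ A' b :=
      Subgroup.mem_sup_right ⟨(A b).mul_mem ((A b).inv_mem (hTA b ht)) ((A b).inv_mem hq), htq⟩
    refine ⟨q * t, hM b (by simpa using inv_mem hmem), ?_⟩
    have h1 := hS.wordDist_triangle_real p q (q * t)
    rw [wordDist_mul_right] at h1
    have h2 : (wordLength S t : ℝ) ≤ B b := hB b ⟨t, ht, rfl⟩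
    have h3 : ρ b + B b ≤ max (ρ false + B false) (ρ true + B true) := by cases b <;> simp
    linarith
  obtain ⟨ε, -, hε⟩ := isQuasiconvex_sup hS h4 hκ (hLA true) hLA' hA' hC le_rfl hc0 hc hR
  have hMqc := hε.gromovQuasiconvex hS hhyp
  have hU : ProfiniteClosed (⋃ x ∈ T false ×ˢ T true, subgroupProd F * {x.1} *
      ((A' false ⊔ A' true : Subgroup G) : Set G) * {x.2⁻¹}) :=
    .biUnion ((hTf _).prod (hTf _)) fun x _ =>
      (hconj F _ x.1 List.prefix_rfl ⟨_, hMqc⟩).mul_singleton _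
  have hgU := hU g fun N' hN' hf' => by
    obtain ⟨n, hn, hgn⟩ := hg N' hN' hf'
    refine ⟨n, hn, ?_⟩
    obtain ⟨_, ⟨f, hf, h, hh, rfl⟩, k, hk, he⟩ := hgn
    obtain ⟨t, ht, hth⟩ := hT false h hh
    obtain ⟨r, hr, hrk⟩ := hT true k⁻¹ (inv_mem hk)
    have h1 : t⁻¹ * h ∈ A' false :=
      Subgroup.mem_sup_right ⟨H.mul_mem (H.inv_mem (hTA _ ht)) hh, hth⟩
    have h2 : r⁻¹ * k⁻¹ ∈ A' true :=
      Subgroup.mem_sup_right ⟨K.mul_mem (K.inv_mem (hTA _ hr)) (K.inv_mem hk), hrk⟩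
    refine Set.mem_biUnion (x := (t, r)) ⟨ht, hr⟩ ⟨f * t * (t⁻¹ * h * (r⁻¹ * k⁻¹)⁻¹),
      ⟨f * t, ⟨f, hf, t, rfl, rfl⟩, _, mul_mem (hM _ h1) (inv_mem (hM _ h2)), rfl⟩, _, rfl, ?_⟩
    rw [← he]
    simp only
    group
  obtain ⟨⟨t, r⟩, ⟨ht, hr⟩, _, ⟨_, ⟨f, hf, _, rfl, rfl⟩, m, hm, rfl⟩, _, rfl, hge⟩ :=
    Set.mem_iUnion₂.mp hgU
  obtain ⟨u, hu, humin, y, hy, he⟩ := exists_mul_altWord (S := S) hLA hLA' hA' (hTA _ ht) hm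
    (inv_mem (hTA _ hr))
  have hgy : g = f * u * y := by
    rw [← hge, mul_assoc f u y, ← he]
    simp only
    group
  have hturn : gromovProd S f g (f * u) ≤ c + κ := by
    have := hy.gromovProd_le hS h4 hκ hA' hC le_rfl hc u hu humin
    rw [← gromovProd_mul_left (f * u), mul_inv_cancel_right, mul_one, ← hgy] at this
    exact this
  obtain ⟨F₁, w, hw, hfu⟩ : ∃ F₁ w, (F₁, w) ∈ I ∧ f * u ∈ subgroupProd F₁ * {w} := by
    rcases h4.le_or_le 1 hturn with h | h
    · rw [hS.gromovProd_comm] at h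
      obtain ⟨F₁, hF₁, w, hw, hmem, hsub⟩ := hD f hf u hu h
      exact ⟨F₁, w, ⟨hF₁, le_max_of_le_left hw, hsub⟩, hmem⟩
    · refine ⟨[], f * u, ⟨by simp, le_max_of_le_right ?_, ?_⟩, ?_⟩
      · have h1 := hS.wordDist_triangle_real 1 g (f * u)
        have h2 := hS.wordDist_comm 1 (f * u)
        have h3 := hS.wordDist_comm g (f * u)
        unfold gromovProd at h
        rw [wordDist_one_left] at h1 h2
        rw [← h2, wordDist_one_left] at h
        rw [h3, wordDist_one_left] at h1
        linarith
      · rw [subgroupProd_nil, Set.singleton_mul_singleton, one_mul, Set.singleton_subset_iff]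
        exact Set.mul_mem_mul hf hu
      · simp [subgroupProd_nil]
  obtain ⟨m', hm', k, hk, rfl⟩ := hy.exists_mul_eq
  obtain ⟨l, hl, n, hn, rfl⟩ := Subgroup.mem_sup_of_normal_right.mp (hMN hm')
  refine hsep₁ _ hw (k⁻¹ * n⁻¹ * k) ?_ ?_
  · have := hN₁.conj_mem n⁻¹ (inv_mem hn.1) k⁻¹
    simpa using this
  · refine ⟨f * u, hfu, l * k, mul_mem hl.2 hk, ?_⟩
    rw [hgy]
    simp only
    group

theorem profiniteClosed_subgroupProd (hS : IsSymmGenSet S) {δ : ℝ} (hδ : 0 ≤ δ)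
    (hhyp : ThinTriangles S δ) (hGFERF : GFERF S) (n : ℕ) :
    ∀ l : List (Subgroup G), l.length ≤ n →
      (∀ A ∈ l, ∃ R, GromovQuasiconvex S R (A : Set G)) → ProfiniteClosed (subgroupProd l) := by
  have hclosed : ∀ H : Subgroup G, (∃ R, GromovQuasiconvex S R (H : Set G)) →
      ProfiniteClosed (H : Set G) := fun H ⟨R, hR⟩ =>
    separableSubset_iff_profiniteClosed.mp (hGFERF H (hR.isQuasiconvex hS))
  induction n with
  | zero =>
    intro l hl _
    rw [List.length_eq_zero_iff.mp (Nat.le_zero.mp hl), subgroupProd_nil, ← Subgroup.coe_bot]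
    refine hclosed ⊥ ⟨0, ?_⟩
    rintro a rfl b rfl p
    exact ⟨1, rfl, by rw [gromovProd_same, add_zero]⟩
  | succ n ih =>
    intro l hl hqc
    rcases l.eq_nil_or_concat with rfl | ⟨l, K, rfl⟩
    · exact ih [] (by simp) (by simp)
    rw [List.concat_eq_append] at hl hqc ⊢
    rcases l.eq_nil_or_concat with rfl | ⟨F, H, rfl⟩
    · simpa [subgroupProd] using hclosed K (hqc K (by simp))
    rw [List.concat_eq_append] at hl hqc ⊢
    obtain ⟨R₁, hH⟩ := hqc H (by simp)
    obtain ⟨R₂, hK⟩ := hqc K (by simp)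
    rw [subgroupProd_concat, subgroupProd_concat]
    simp only [List.length_append, List.length_singleton] at hl
    exact profiniteClosed_mul_mul hS hδ hhyp hGFERF F H K (fun A hA => hqc A (by simp [hA])) hH hK
      fun l' hl' => ih l' (by omega)

end Products

/-- **Theorem 1.** In a GFERF word hyperbolic group `G`, the product of finitely many
quasiconvex subgroups `G₁ G₂ ⋯ G_s` is separable (closed in the profinite topology). -/
theorem product_of_quasiconvex_subgroups_separable
    {G : Type*} [Group G] (S : Set G) (hS : IsSymmGenSet S)
    (δ : ℝ) (hδ : 0 ≤ δ) (hhyp : ThinTriangles S δ) (hGFERF : GFERF S)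
    (s : ℕ) (hs : 0 < s) (Gs : Fin s → Subgroup G)
    (hqc : ∀ i, ∃ ε : ℝ, 0 ≤ ε ∧ IsQuasiconvex S ε ((Gs i : Set G))) :
    SeparableSubset G
      {g : G | ∃ f : Fin s → G, (∀ i, f i ∈ Gs i) ∧ (List.ofFn f).prod = g} := by
  have key := profiniteClosed_subgroupProd hS hδ hhyp hGFERF s (List.ofFn Gs) (by simp) (by
    intro A hA
    obtain ⟨i, rfl⟩ := List.mem_ofFn.mp hA
    obtain ⟨ε, -, hε⟩ := hqc i
    exact ⟨_, hε.gromovQuasiconvex hS hhyp⟩)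
  rw [separableSubset_iff_profiniteClosed]
  convert key using 1
  ext g
  rw [subgroupProd, List.map_ofFn, Set.mem_prod_list_ofFn]
  exact ⟨fun ⟨f, hf, he⟩ => ⟨fun i => ⟨f i, hf i⟩, he⟩,
    fun ⟨f, he⟩ => ⟨fun i => f i, fun i => (f i).2, he⟩⟩
end

section
/- In a free group F of finite rank, the product H_1 H_2 ⋯ H_s of finitely many finitely generated subgroups H_1, ..., H_s of F is separable in F, i.e. closed in the profinite topology on F. -/
open scoped Pointwise

open Equiv (Perm)

namespace RibesZalesskii

universe u

variable {α : Type*} {X Y Z : Type*}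

/-- The permutation attached to a letter `a` or `a⁻¹` when each `a : α` permutes `Y`. -/
def letterPerm (f : α → Perm Y) (l : α × Bool) : Perm Y :=
  cond l.2 (f l.1) (f l.1)⁻¹

/-- The endpoint of the path starting at `y` and labelled by a word, read from left to right. -/
def run (f : α → Perm Y) : List (α × Bool) → Y → Y
  | [], y => y
  | l :: w, y => run f w (letterPerm f l y)

@[simp] lemma letterPerm_true (f : α → Perm Y) (a : α) : letterPerm f (a, true) = f a := rfl

@[simp] lemma letterPerm_false (f : α → Perm Y) (a : α) : letterPerm f (a, false) = (f a)⁻¹ := rfl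

@[simp] lemma run_nil (f : α → Perm Y) (y : Y) : run f [] y = y := rfl

@[simp] lemma run_cons (f : α → Perm Y) (l : α × Bool) (w : List (α × Bool)) (y : Y) :
    run f (l :: w) y = run f w (letterPerm f l y) := rfl

lemma run_append (f : α → Perm Y) (w w' : List (α × Bool)) (y : Y) :
    run f (w ++ w') y = run f w' (run f w y) := by
  induction w generalizing y with
  | nil => rfl
  | cons l w ih => exact ih _

/-- A map commuting with the generators commutes with all words. -/
lemma map_run {f : α → Perm Y} {g : α → Perm Z} (φ : Y → Z)
    (h : ∀ a y, φ (f a y) = g a (φ y)) (w : List (α × Bool)) (y : Y) :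
    φ (run f w y) = run g w (φ y) := by
  induction w generalizing y with
  | nil => rfl
  | cons l w ih =>
    rw [run_cons, run_cons, ih]
    congr 1
    obtain ⟨a, _ | _⟩ := l
    · simp only [letterPerm_false]
      rw [Equiv.Perm.eq_inv_iff_eq, ← h]
      simp
    · exact h a y

/-- The free group acts from the right through `run`. -/
lemma run_eq_lift (f : α → Perm Y) (w : List (α × Bool)) (y : Y) :
    run f w y = (FreeGroup.lift (fun a => (f a)⁻¹) (FreeGroup.mk w))⁻¹ y := by
  induction w generalizing y with
  | nil => rw [← FreeGroup.one_eq_mk, map_one]; rfl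
  | cons l w ih =>
    rw [run_cons, ih]
    have : FreeGroup.mk (l :: w) = FreeGroup.mk [l] * FreeGroup.mk w := by
      simp [FreeGroup.mul_mk]
    rw [this, map_mul, mul_inv_rev, Equiv.Perm.mul_apply]
    congr 1
    obtain ⟨a, _ | _⟩ := l <;> simp

/-- The right translations of the free group by its basis. -/
def translation (α : Type*) (a : α) : Perm (FreeGroup α) := Equiv.mulRight (FreeGroup.of a)

lemma run_translation (w : List (α × Bool)) (g : FreeGroup α) :
    run (translation α) w g = g * FreeGroup.mk w := by
  induction w generalizing g with
  | nil => rw [← FreeGroup.one_eq_mk, mul_one]; rfl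
  | cons l w ih =>
    have : FreeGroup.mk (l :: w) = FreeGroup.mk [l] * FreeGroup.mk w := by
      simp [FreeGroup.mul_mk]
    rw [run_cons, ih, this, ← mul_assoc]
    congr 1
    obtain ⟨a, _ | _⟩ := l
    · simp [translation, FreeGroup.of, FreeGroup.inv_mk, FreeGroup.invRev]
    · simp [translation, FreeGroup.of]

/-- A subgraph of the Schreier graph of permutations of `X` indexed by `α`: the edge labelled `a`
from `x` to `perm a x` belongs to the subgraph when `edge x a` holds. -/
structure PermGraph (α X : Type*) where
  /-- the permutations -/
  perm : α → Perm X
  /-- the edges of the subgraph -/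
  edge : X → α → Prop

namespace PermGraph

variable (Γ : PermGraph α X)

/-- The letter `l` labels an edge of the subgraph, possibly traversed backwards, starting at `x`. -/
def Allowed (x : X) (l : α × Bool) : Prop :=
  cond l.2 (Γ.edge x l.1) (Γ.edge ((Γ.perm l.1)⁻¹ x) l.1)

/-- The word labels a path of the subgraph from `p` to `q`. -/
def Reads : X → List (α × Bool) → X → Prop
  | p, [], q => p = q
  | p, l :: w, q => Γ.Allowed p l ∧ Reads (letterPerm Γ.perm l p) w q

variable {Γ}

@[simp] lemma allowed_true {x : X} {a : α} : Γ.Allowed x (a, true) ↔ Γ.edge x a := Iff.rfl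

@[simp] lemma allowed_false {x : X} {a : α} :
    Γ.Allowed x (a, false) ↔ Γ.edge ((Γ.perm a)⁻¹ x) a := Iff.rfl

lemma Reads.run_eq {p q : X} {w : List (α × Bool)} (h : Γ.Reads p w q) :
    run Γ.perm w p = q := by
  induction w generalizing p with
  | nil => exact h
  | cons l w ih => exact ih h.2

lemma Reads.append {p q r : X} {w w' : List (α × Bool)} (h : Γ.Reads p w q)
    (h' : Γ.Reads q w' r) : Γ.Reads p (w ++ w') r := by
  induction w generalizing p with
  | nil => obtain rfl : p = q := h; exact h'
  | cons l w ih => exact ⟨h.1, ih h.2⟩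

lemma reads_singleton {p : X} {l : α × Bool} (h : Γ.Allowed p l) :
    Γ.Reads p [l] (letterPerm Γ.perm l p) := ⟨h, rfl⟩

variable (Γ)

/-- Some label of a path of the subgraph from `p` to `q` leads from `y` to `z`. -/
def Seg (f : α → Perm Y) (p q : X) (y z : Y) : Prop :=
  ∃ w, Γ.Reads p w q ∧ run f w y = z

/-- A path from `y` to `z` composed of consecutive segments with prescribed endpoints in `X`. -/
def Chain (f : α → Perm Y) : List (X × X) → Y → Y → Prop
  | [], y, z => y = z
  | s :: L, y, z => ∃ y', Γ.Seg f s.1 s.2 y y' ∧ Chain f L y' z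

variable {Γ} {f : α → Perm Y}

lemma Seg.refl (p : X) (y : Y) : Γ.Seg f p p y y := ⟨[], rfl, rfl⟩

lemma Seg.trans {p q r : X} {x y z : Y} (h : Γ.Seg f p q x y) (h' : Γ.Seg f q r y z) :
    Γ.Seg f p r x z := by
  obtain ⟨w, hw, rfl⟩ := h
  obtain ⟨w', hw', rfl⟩ := h'
  exact ⟨w ++ w', hw.append hw', run_append ..⟩

lemma seg_letter {p : X} {l : α × Bool} (h : Γ.Allowed p l) (y : Y) :
    Γ.Seg f p (letterPerm Γ.perm l p) y (letterPerm f l y) :=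
  ⟨[l], reads_singleton h, rfl⟩

lemma seg_edge {p : X} {a : α} (h : Γ.edge p a) (y : Y) :
    Γ.Seg f p (Γ.perm a p) y (f a y) :=
  seg_letter (l := (a, true)) h y

lemma seg_edge_symm {p : X} {a : α} (h : Γ.edge p a) (y : Y) :
    Γ.Seg f (Γ.perm a p) p (f a y) y := by
  have := seg_letter (f := f) (l := (a, false)) (p := Γ.perm a p) (Γ := Γ) (by simpa using h)
    (f a y)
  simpa using this

lemma seg_letter_symm {p : X} {l : α × Bool} (h : Γ.Allowed p l) (y : Y) :
    Γ.Seg f (letterPerm Γ.perm l p) p (letterPerm f l y) y := by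
  obtain ⟨a, _ | _⟩ := l
  · simpa using seg_edge (f := f) (allowed_false.1 h) ((f a)⁻¹ y)
  · exact seg_edge_symm h y

lemma Seg.symm {p q : X} {y z : Y} (h : Γ.Seg f p q y z) : Γ.Seg f q p z y := by
  obtain ⟨w, hw, hz⟩ := h
  induction w generalizing p y with
  | nil =>
    obtain rfl : p = q := hw
    obtain rfl : y = z := hz
    exact Seg.refl p y
  | cons l w ih => exact (ih hw.2 hz).trans (seg_letter_symm hw.1 y)

lemma Seg.map {g : α → Perm Z} (φ : Y → Z) (h : ∀ a y, φ (f a y) = g a (φ y)) {p q : X} {y z : Y}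
    (hs : Γ.Seg f p q y z) : Γ.Seg g p q (φ y) (φ z) := by
  obtain ⟨w, hw, rfl⟩ := hs
  exact ⟨w, hw, (map_run φ h w y).symm⟩

lemma Chain.map {g : α → Perm Z} (φ : Y → Z) (h : ∀ a y, φ (f a y) = g a (φ y))
    {L : List (X × X)} {y z : Y} (hs : Γ.Chain f L y z) : Γ.Chain g L (φ y) (φ z) := by
  induction L generalizing y with
  | nil => exact congrArg φ hs
  | cons s L ih =>
    obtain ⟨y', h₁, h₂⟩ := hs
    exact ⟨φ y', h₁.map φ h, ih h₂⟩

lemma chain_singleton {s : X × X} {y z : Y} :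
    Γ.Chain f [s] y z ↔ Γ.Seg f s.1 s.2 y z :=
  ⟨fun ⟨_, h, h'⟩ => h' ▸ h, fun h => ⟨z, h, rfl⟩⟩

lemma chain_append {L L' : List (X × X)} {y z : Y} :
    Γ.Chain f (L ++ L') y z ↔ ∃ x, Γ.Chain f L y x ∧ Γ.Chain f L' x z := by
  induction L generalizing y with
  | nil => exact ⟨fun h => ⟨y, rfl, h⟩, fun ⟨x, h, h'⟩ => by cases h; exact h'⟩
  | cons s L ih =>
    constructor
    · rintro ⟨y', h₁, h₂⟩
      obtain ⟨x, h₃, h₄⟩ := ih.1 h₂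
      exact ⟨x, ⟨y', h₁, h₃⟩, h₄⟩
    · rintro ⟨x, ⟨y', h₁, h₃⟩, h₄⟩
      exact ⟨y', h₁, ih.2 ⟨x, h₃, h₄⟩⟩

lemma Chain.cons {p q : X} {L : List (X × X)} {x y z : Y} (h : Γ.Seg f p q x y)
    (h' : Γ.Chain f L y z) : Γ.Chain f ((p, q) :: L) x z := ⟨y, h, h'⟩

lemma Chain.append {L L' : List (X × X)} {x y z : Y} (h : Γ.Chain f L x y)
    (h' : Γ.Chain f L' y z) : Γ.Chain f (L ++ L') x z := chain_append.2 ⟨y, h, h'⟩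

lemma Chain.snoc {p q : X} {L : List (X × X)} {x y z : Y} (h : Γ.Chain f L x y)
    (h' : Γ.Seg f p q y z) : Γ.Chain f (L ++ [(p, q)]) x z :=
  h.append (chain_singleton.2 h')

lemma Seg.translate {p q : X} {g g' : FreeGroup α} (h : Γ.Seg (translation α) p q g g')
    (k : FreeGroup α) : Γ.Seg (translation α) p q (k * g) (k * g') :=
  h.map (fun x => k * x) fun _ _ => (mul_assoc ..).symm

lemma Chain.translate {L : List (X × X)} {g g' : FreeGroup α}
    (h : Γ.Chain (translation α) L g g') (k : FreeGroup α) :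
    Γ.Chain (translation α) L (k * g) (k * g') :=
  h.map (fun x => k * x) fun _ _ => (mul_assoc ..).symm

variable (Γ)

/-- The chain of sides `L` can be realised by a closed path in the Cayley tree. -/
def Closes (L : List (X × X)) : Prop :=
  ∃ g, Γ.Chain (translation α) L g g

variable {Γ}

lemma Closes.chain {L : List (X × X)} (h : Γ.Closes L) (g : FreeGroup α) :
    Γ.Chain (translation α) L g g := by
  obtain ⟨k, hk⟩ := h
  simpa using hk.translate (g * k⁻¹)

/-- Two closed polygons glued at a common vertex of the two sides `(p₁, q₁)` and `(p, q)`. -/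
lemma Closes.glue {p₁ r₁ q₁ p r q : X} {L₁ L₂ : List (X × X)}
    (h : Γ.Closes ((r₁, q₁) :: (L₁ ++ [(p, r)])))
    (h' : Γ.Closes ((r, q) :: (L₂ ++ [(p₁, r₁)]))) :
    Γ.Closes ((p₁, q₁) :: (L₁ ++ (p, q) :: L₂)) := by
  obtain ⟨a, ha, hL⟩ := h.chain 1
  obtain ⟨b, hb, hr⟩ := chain_append.1 hL
  obtain ⟨c, hc, hL'⟩ := h'.chain 1
  obtain ⟨d, hd, hr'⟩ := chain_append.1 hL'
  exact ⟨d, .cons ((chain_singleton.1 hr').trans ha)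
    (hb.append (.cons ((chain_singleton.1 hr).trans hc) hd))⟩

/-- Three closed polygons glued at a common vertex of three consecutive sides. -/
lemma Closes.glue_three {p₁ r₁ q₁ p₂ r₂ q₂ p r q : X} {M : List (X × X)}
    (h₁ : Γ.Closes [(r₁, q₁), (p₂, r₂)]) (h₂ : Γ.Closes ((r₂, q₂) :: (M ++ [(p, r)])))
    (h₃ : Γ.Closes [(r, q), (p₁, r₁)]) :
    Γ.Closes ((p₁, q₁) :: (p₂, q₂) :: (M ++ [(p, q)])) := by
  obtain ⟨a, ha, ha'⟩ := h₁.chain 1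
  obtain ⟨b, hb, hL⟩ := h₂.chain 1
  obtain ⟨c, hc, hr⟩ := chain_append.1 hL
  obtain ⟨d, hd, hd'⟩ := h₃.chain 1
  exact ⟨d, .cons ((chain_singleton.1 hd').trans ha) (.cons ((chain_singleton.1 ha').trans hb)
    (hc.snoc ((chain_singleton.1 hr).trans hd)))⟩

variable (Γ)

/-- Closed chains in `Y` with at most `k` sides can be realised by closed paths in the
Cayley tree. -/
def Resolves (k : ℕ) (f : α → Perm Y) : Prop :=
  ∀ L : List (X × X), L.length ≤ k → ∀ y, Γ.Chain f L y y → Γ.Closes L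

/-- The endpoints of paths in `Y` determine the action of their labels on `X`. -/
def Refines (f : α → Perm Y) : Prop :=
  ∀ w w' y, run f w y = run f w' y → ∀ x, run Γ.perm w x = run Γ.perm w' x

variable {Γ}

lemma Refines.eq_of_seg (hf : Γ.Refines f) {p r r' : X} {y z : Y} (h : Γ.Seg f p r y z)
    (h' : Γ.Seg f p r' y z) : r = r' := by
  obtain ⟨w, hw, rfl⟩ := h
  obtain ⟨w', hw', he⟩ := h'
  rw [← hw.run_eq, ← hw'.run_eq]
  exact (hf _ _ _ he p).symm

lemma Refines.resolves_one (hf : Γ.Refines f) : Γ.Resolves 1 f := by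
  rintro (_ | ⟨s, _ | ⟨t, L⟩⟩) hL y h
  · exact ⟨1, rfl⟩
  · have := hf.eq_of_seg (Seg.refl s.1 y) (chain_singleton.1 h)
    exact ⟨1, chain_singleton.2 (this ▸ Seg.refl s.1 1)⟩
  · simp at hL

end PermGraph

section Extension

open PermGraph

variable [DecidableEq Y] [DecidableEq α]

/-- The extension of `Y` recording the parity of the number of passages of a path through each
edge. -/
def parityExt (f : α → Perm Y) (a : α) : Perm (Y × (Y × α → ZMod 2)) where
  toFun x := (f a x.1, x.2 + Pi.single (x.1, a) 1)
  invFun x := ((f a)⁻¹ x.1, x.2 + Pi.single ((f a)⁻¹ x.1, a) 1)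
  left_inv x := by
    ext <;> simp [add_assoc, CharTwo.add_self_eq_zero]
  right_inv x := by
    ext <;> simp [add_assoc, CharTwo.add_self_eq_zero]

variable {Γ : PermGraph α X} {f : α → Perm Y}

lemma fst_run_parityExt (w : List (α × Bool)) (x : Y × (Y × α → ZMod 2)) :
    (run (parityExt f) w x).1 = run f w x.1 :=
  map_run Prod.fst (fun _ _ => rfl) w x

lemma parityExt_inv_apply (a : α) (x : Y × (Y × α → ZMod 2)) :
    (parityExt f a)⁻¹ x = ((f a)⁻¹ x.1, x.2 + Pi.single ((f a)⁻¹ x.1, a) 1) := rfl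

lemma parityExt_apply (a : α) (x : Y × (Y × α → ZMod 2)) :
    parityExt f a x = (f a x.1, x.2 + Pi.single (x.1, a) 1) := rfl

/-- A segment changing the parity at an edge passes through that edge. -/
lemma seg_of_parity_ne {p q : X} {x z : Y × (Y × α → ZMod 2)}
    (h : Γ.Seg (parityExt f) p q x z) {e : Y × α} (he : x.2 e ≠ z.2 e) :
    ∃ r, Γ.edge r e.2 ∧ Γ.Seg f p r x.1 e.1 ∧ Γ.Seg f r q e.1 z.1 := by
  obtain ⟨w, hw, hz⟩ := h
  induction w generalizing p x with
  | nil => exact absurd (congrArg (fun t => t.2 e) hz) he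
  | cons l w ih =>
    have hfst : (letterPerm (parityExt f) l x).1 = letterPerm f l x.1 := by
      obtain ⟨a, _ | _⟩ := l <;> rfl
    by_cases hc : (letterPerm (parityExt f) l x).2 e = z.2 e
    · have htail : Γ.Seg f (letterPerm Γ.perm l p) q (letterPerm f l x.1) z.1 :=
        ⟨w, hw.2, by rw [← hz, run_cons, fst_run_parityExt, hfst]⟩
      have hne : (letterPerm (parityExt f) l x).2 e ≠ x.2 e := fun h => he (h.symm.trans hc)
      have hl := hw.1
      obtain ⟨a, _ | _⟩ := l
      · have hee : e = ((f a)⁻¹ x.1, a) := by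
          by_contra h
          refine hne ?_
          rw [letterPerm_false, parityExt_inv_apply]
          dsimp only
          rw [Pi.add_apply, Pi.single_eq_of_ne h, add_zero]
        subst hee
        exact ⟨(Γ.perm a)⁻¹ p, hl, seg_letter hl x.1, htail⟩
      · have hee : e = (x.1, a) := by
          by_contra h
          exact hne (by simp [parityExt_apply, Pi.single_eq_of_ne h])
        subst hee
        exact ⟨p, hl, Seg.refl _ _, (seg_letter hl x.1).trans htail⟩
    · obtain ⟨r, h₁, h₂, h₃⟩ := ih hc hw.2 hz
      rw [hfst] at h₂
      exact ⟨r, h₁, (seg_letter hw.1 x.1).trans h₂, h₃⟩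

/-- A chain changing the parity at an edge has a side passing through that edge. -/
lemma chain_of_parity_ne {L : List (X × X)} {x z : Y × (Y × α → ZMod 2)}
    (h : Γ.Chain (parityExt f) L x z) {e : Y × α} (he : x.2 e ≠ z.2 e) :
    ∃ L₁ p q L₂ y₁ y₂ r, L = L₁ ++ (p, q) :: L₂ ∧ Γ.Chain f L₁ x.1 y₁ ∧ Γ.Seg f p r y₁ e.1 ∧
      Γ.Seg f r q e.1 y₂ ∧ Γ.Chain f L₂ y₂ z.1 := by
  induction L generalizing x with
  | nil => exact absurd (congrArg (fun t => t.2 e) h) he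
  | cons s L ih =>
    obtain ⟨x', h₁, h₂⟩ := h
    by_cases hc : x'.2 e = z.2 e
    · obtain ⟨r, -, hr, hr'⟩ := seg_of_parity_ne h₁ (e := e) (by rwa [hc])
      exact ⟨[], s.1, s.2, L, x.1, x'.1, r, rfl, rfl, hr, hr', h₂.map Prod.fst fun _ _ => rfl⟩
    · obtain ⟨L₁, p, q, L₂, y₁, y₂, r, rfl, h₃, h₄⟩ := ih h₂ hc
      exact ⟨s :: L₁, p, q, L₂, y₁, y₂, r, rfl, .cons (h₁.map Prod.fst fun _ _ => rfl) h₃, h₄⟩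

/-- If no edge whose parity changes crosses the cut `S`, the path ends on the side of `S` where
it started. -/
lemma mem_iff_mem_of_cut [Fintype Y] [Fintype α] (S : Set Y) {p q : X}
    {x z : Y × (Y × α → ZMod 2)} (h : Γ.Seg (parityExt f) p q x z)
    (hS : ∀ v a, x.2 (v, a) ≠ z.2 (v, a) → (v ∈ S ↔ f a v ∈ S)) : x.1 ∈ S ↔ z.1 ∈ S := by
  classical
  obtain ⟨w, -, hz⟩ := h
  let c : Y → ZMod 2 := S.indicator 1
  let δ : Y × α → ZMod 2 := fun e => c (f e.2 e.1) + c e.1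
  let I : Y × (Y × α → ZMod 2) → ZMod 2 := fun x => c x.1 + ∑ e, x.2 e * δ e
  have hI : ∀ a x, I (parityExt f a x) = I x := by
    intro a x
    simp only [I, parityExt_apply, Pi.add_apply, add_mul, Finset.sum_add_distrib]
    have : ∑ e, (Pi.single (x.1, a) 1 : Y × α → ZMod 2) e * δ e = δ (x.1, a) := by
      simp [Pi.single_apply]
    rw [this]
    have h2 : c (f a x.1) + c (f a x.1) = 0 := CharTwo.add_self_eq_zero _
    simp only [δ]
    linear_combination h2
  have hrun : I z = I x := by
    have := map_run (g := fun _ => (1 : Perm (ZMod 2))) I hI w x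
    rw [hz] at this
    rw [this, run_eq_lift]
    simp only [inv_one]
    have h1 : (FreeGroup.lift fun _ : α => (1 : Perm (ZMod 2))) = 1 := by ext; simp
    rw [h1]; simp
  have hsum : ∑ e, z.2 e * δ e = ∑ e, x.2 e * δ e := by
    refine Finset.sum_congr rfl fun e _ => ?_
    by_cases he : x.2 e = z.2 e
    · rw [he]
    · have hd : δ e = 0 := by
        have := hS e.1 e.2 he
        by_cases hv : e.1 ∈ S
        · simp [δ, c, Set.indicator_of_mem hv, Set.indicator_of_mem (this.1 hv),
            CharTwo.add_self_eq_zero]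
        · simp [δ, c, Set.indicator_of_notMem hv,
            Set.indicator_of_notMem (fun h => hv (this.2 h))]
      rw [hd, mul_zero, mul_zero]
  have hc : c z.1 = c x.1 := by
    simp only [I, hsum] at hrun
    exact add_right_cancel hrun
  by_cases hx : x.1 ∈ S <;> by_cases hz' : z.1 ∈ S <;> simp_all [c]

/-- Two sides sharing endpoints in the extension have a common label. -/
lemma closes_pair [Fintype Y] [Fintype α] (hf : Γ.Refines f) {p₁ q₁ p₂ q₂ : X}
    {x z : Y × (Y × α → ZMod 2)} (h₁ : Γ.Seg (parityExt f) p₁ q₁ x z)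
    (h₂ : Γ.Seg (parityExt f) p₂ q₂ z x) : Γ.Closes [(p₁, q₁), (p₂, q₂)] := by
  let S : Set Y := {v | ∃ u r r', Γ.Reads p₁ u r ∧ Γ.Reads q₂ u r' ∧ run f u x.1 = v}
  have hx : x.1 ∈ S := ⟨[], p₁, q₂, rfl, rfl, rfl⟩
  have key : ∀ v a, x.2 (v, a) ≠ z.2 (v, a) → (v ∈ S ↔ f a v ∈ S) := by
    intro v a he
    obtain ⟨r₁, hr₁, h, -⟩ := seg_of_parity_ne h₁ he
    obtain ⟨r₂, hr₂, -, h'⟩ := seg_of_parity_ne h₂ he.symm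
    constructor
    · rintro ⟨u, r, r', hu, hu', hv⟩
      obtain rfl := hf.eq_of_seg h ⟨u, hu, hv⟩
      obtain rfl := hf.eq_of_seg h'.symm ⟨u, hu', hv⟩
      exact ⟨u ++ [(a, true)], _, _, hu.append (reads_singleton hr₁),
        hu'.append (reads_singleton hr₂), by rw [run_append, hv]; rfl⟩
    · rintro ⟨u, r, r', hu, hu', hv⟩
      obtain rfl := hf.eq_of_seg (h.trans (seg_edge hr₁ v)) ⟨u, hu, hv⟩
      obtain rfl := hf.eq_of_seg (h'.symm.trans (seg_edge hr₂ v)) ⟨u, hu', hv⟩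
      refine ⟨u ++ [(a, false)], _, _, hu.append (reads_singleton ?_),
        hu'.append (reads_singleton ?_), by rw [run_append, hv]; simp⟩
      · simpa using hr₁
      · simpa using hr₂
  obtain ⟨u, r, r', hu, hu', hv⟩ := (mem_iff_mem_of_cut S h₁ key).1 hx
  obtain rfl := hf.eq_of_seg (h₁.map Prod.fst fun _ _ => rfl) ⟨u, hu, hv⟩
  obtain rfl := hf.eq_of_seg (h₂.map Prod.fst fun _ _ => rfl).symm ⟨u, hu', hv⟩
  exact ⟨1, _, ⟨u, hu, rfl⟩, chain_singleton.2 (Seg.symm ⟨u, hu', rfl⟩)⟩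

/-- Polygons with at least three sides closing up in the extension can be cut into polygons with
fewer sides. -/
lemma closes_polygon [Fintype Y] [Fintype α] {k : ℕ} (hf : Γ.Resolves k f)
    {p₁ q₁ p₂ q₂ p q : X} {M : List (X × X)} (hM : M.length + 2 ≤ k)
    {x : Y × (Y × α → ZMod 2)}
    (h : Γ.Chain (parityExt f) ((p₁, q₁) :: (p₂, q₂) :: (M ++ [(p, q)])) x x) :
    Γ.Closes ((p₁, q₁) :: (p₂, q₂) :: (M ++ [(p, q)])) := by
  obtain ⟨z, h₁, z', h₂, hM'⟩ := h
  obtain ⟨z'', h₃, hlast⟩ := chain_append.1 hM'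
  have h := chain_singleton.1 hlast
  dsimp only at h₁ h₂ h
  have proj : ∀ {p q : X} {x z : Y × (Y × α → ZMod 2)}, Γ.Seg (parityExt f) p q x z →
      Γ.Seg f p q x.1 z.1 := fun h => h.map Prod.fst fun _ _ => rfl
  have h₃' : Γ.Chain f M z'.1 z''.1 := h₃.map Prod.fst fun _ _ => rfl
  by_contra hcl
  have three : ∀ {v r₁ r₂ r}, Γ.Seg f p₁ r₁ x.1 v → Γ.Seg f r₁ q₁ v z.1 →
      Γ.Seg f p₂ r₂ z.1 v → Γ.Seg f r₂ q₂ v z'.1 →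
      Γ.Seg f p r z''.1 v → Γ.Seg f r q v x.1 → False := by
    intro v r₁ r₂ r a₁ b₁ a₂ b₂ a b
    refine hcl (Closes.glue_three (r₁ := r₁) (r₂ := r₂) (r := r) ?_ ?_ ?_)
    · exact hf _ (by simp; omega) v (.cons b₁ (chain_singleton.2 a₂))
    · exact hf _ (by simp; omega) v (.cons b₂ (h₃'.snoc a))
    · exact hf _ (by simp; omega) v (.cons b (chain_singleton.2 a₁))
  let S : Set Y := {v | (∃ r, Γ.Seg f p₁ r x.1 v ∧ Γ.Seg f r q₁ v z.1) ∧
    ∃ r, Γ.Seg f p r z''.1 v ∧ Γ.Seg f r q v x.1}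
  have hx : x.1 ∈ S := ⟨⟨p₁, Seg.refl _ _, proj h₁⟩, q, proj h, Seg.refl _ _⟩
  have hz : z.1 ∉ S := by
    rintro ⟨⟨r₁, a₁, b₁⟩, r, a, b⟩
    exact three a₁ b₁ (Seg.refl _ _) (proj h₂) a b
  refine hz ((mem_iff_mem_of_cut S h₁ fun v a he => ?_).1 hx)
  obtain ⟨r₁, e₁, a₁, b₁⟩ := seg_of_parity_ne h₁ he
  have a₁' := a₁.trans (seg_edge e₁ v)
  have b₁' := (seg_edge_symm e₁ v).trans b₁
  by_cases c₂ : z.2 (v, a) = z'.2 (v, a)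
  · by_cases c₃ : z'.2 (v, a) = z''.2 (v, a)
    · obtain ⟨r, e, a, b⟩ := seg_of_parity_ne h (e := (v, a)) (by rw [← c₃, ← c₂]; exact he.symm)
      exact iff_of_true ⟨⟨r₁, a₁, b₁⟩, r, a, b⟩
        ⟨⟨_, a₁', b₁'⟩, _, a.trans (seg_edge e v), (seg_edge_symm e v).trans b⟩
    · obtain ⟨L₁, p', q', L₂, y₁, y₂, r, rfl, hL₁, a, b, hL₂⟩ := chain_of_parity_ne h₃ c₃
      simp only [List.length_append, List.length_cons] at hM
      refine absurd ?_ hcl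
      have := Closes.glue (Γ := Γ) (p₁ := p₁) (r₁ := r₁) (q₁ := q₁) (p := p') (r := r) (q := q')
        (L₁ := (p₂, q₂) :: L₁) (L₂ := L₂ ++ [(p, q)])
        (hf _ (by simp; omega) v (.cons b₁ (Chain.snoc (.cons (proj h₂) hL₁) a)))
        (hf _ (by simp; omega) v (.cons b ((hL₂.snoc (proj h)).snoc a₁)))
      simpa using this
  · obtain ⟨r₂, e₂, a₂, b₂⟩ := seg_of_parity_ne h₂ c₂
    refine iff_of_false ?_ ?_
    · rintro ⟨-, r, a, b⟩
      exact three a₁ b₁ a₂ b₂ a b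
    · rintro ⟨-, r, a, b⟩
      exact three a₁' b₁' (a₂.trans (seg_edge e₂ v)) ((seg_edge_symm e₂ v).trans b₂) a b

lemma resolves_parityExt [Fintype Y] [Fintype α] {k : ℕ} (hf : Γ.Refines f)
    (hk : Γ.Resolves k f) : Γ.Resolves (k + 1) (parityExt f) := by
  intro L hL x h
  rcases Nat.lt_or_ge k L.length with hlt | hle
  · obtain _ | ⟨s₁, _ | ⟨s₂, L⟩⟩ := L
    · simp at hlt
    · exact hf.resolves_one _ (by simp) _ (h.map Prod.fst fun _ _ => rfl)
    · rcases List.eq_nil_or_concat' L with rfl | ⟨M, s, rfl⟩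
      · obtain ⟨z, h₁, h₂⟩ := h
        exact closes_pair hf h₁ (chain_singleton.1 h₂)
      · exact closes_polygon hk (by simp at hL; omega) h
  · exact hk L hle x.1 (h.map Prod.fst fun _ _ => rfl)

lemma refines_parityExt (hf : Γ.Refines f) : Γ.Refines (parityExt f) := by
  intro w w' x h
  refine hf w w' x.1 ?_
  rw [← fst_run_parityExt, ← fst_run_parityExt, h]

end Extension

/-- Every finite graph of permutations has finite extensions resolving polygons with any bounded
number of sides. -/
theorem exists_resolves {α X : Type u} [Finite α] [Finite X] (Γ : PermGraph α X) (k : ℕ) :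
    ∃ (Y : Type u) (_ : Finite Y) (_ : Nonempty Y) (f : α → Perm Y),
      Γ.Refines f ∧ Γ.Resolves (k + 1) f := by
  classical
  induction k with
  | zero =>
    have hf : Γ.Refines (fun a => Equiv.mulLeft (Γ.perm a)) := by
      intro w w' τ h x
      have key : ∀ w, (run (fun a => Equiv.mulLeft (Γ.perm a)) w τ) (τ⁻¹ x) = run Γ.perm w x := by
        intro w
        have := map_run (f := fun a => Equiv.mulLeft (Γ.perm a)) (g := Γ.perm)
          (fun ρ : Perm X => ρ (τ⁻¹ x)) (fun _ _ => rfl) w τ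
        simpa using this
      rw [← key, ← key, h]
    exact ⟨Perm X, inferInstance, inferInstance, _, hf, hf.resolves_one⟩
  | succ k ih =>
    obtain ⟨Y, _, _, f, hf, hk⟩ := ih
    have := Fintype.ofFinite Y
    have := Fintype.ofFinite α
    exact ⟨Y × (Y × α → ZMod 2), inferInstance, inferInstance, parityExt f,
      refines_parityExt hf, resolves_parityExt hf hk⟩

/-- A finite set of vertices of a Schreier graph spans a subgraph of a finite Schreier graph. -/
theorem exists_permGraph (f : α → Perm Z) (V : Finset Z) :
    ∃ Γ : PermGraph α V, (∀ p w q, Γ.Reads p w q → run f w p = q) ∧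
      ∀ (p : V) w (q : V), (∀ u, u <+: w → run f u p ∈ V) → run f w p = q → Γ.Reads p w q := by
  classical
  have hex : ∀ a, ∃ σ : Perm V, ∀ x : V, f a x ∈ V → (σ x : Z) = f a x := by
    intro a
    obtain ⟨g, hg⟩ := Set.MapsTo.exists_equiv_extend_of_card_eq (t := V) (Fintype.card_coe V)
      (s := {x : V | f a x ∈ V}) (f := fun x => f a x) (fun _ hx => hx)
      (fun x _ y _ h => Subtype.ext ((f a).injective h))
    exact ⟨g, fun x hx => hg x hx⟩
  choose σ hσ using hex
  let Γ : PermGraph α V := ⟨σ, fun x a => f a x ∈ V⟩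
  have step : ∀ (x : V) l, Γ.Allowed x l → (letterPerm σ l x : Z) = letterPerm f l x := by
    rintro x ⟨a, _ | _⟩ h
    · have := hσ a _ h
      simp only [letterPerm_false]
      rw [Equiv.Perm.eq_inv_iff_eq]
      simpa [Γ] using this.symm
    · exact hσ a x h
  have allowed : ∀ (x : V) l, letterPerm f l x ∈ V → Γ.Allowed x l := by
    rintro x ⟨a, _ | _⟩ h
    · simp only [letterPerm_false] at h
      have hx : σ a ⟨_, h⟩ = x := Subtype.ext (by rw [hσ a] <;> simp)
      change f a ((σ a)⁻¹ x : V) ∈ V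
      rw [← hx]
      simp
    · exact h
  refine ⟨Γ, fun p w q h => ?_, fun p w q hw h => ?_⟩
  · induction w generalizing p with
    | nil => exact congrArg Subtype.val h
    | cons l w ih =>
      rw [run_cons, ← step p l h.1]
      exact ih _ h.2
  · induction w generalizing p with
    | nil => exact Subtype.ext h
    | cons l w ih =>
      have hl : Γ.Allowed p l := allowed p l (hw [l] (by simp))
      refine ⟨hl, ih _ (fun u hu => ?_) ?_⟩
      · change run f u (letterPerm σ l p : V) ∈ V
        rw [step p l hl]
        exact hw (l :: u) (by simpa using hu)
      · change run f w (letterPerm σ l p : V) = q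
        rw [step p l hl]
        exact h

/-- Finitely many subgroups of a free group, with finitely many elements marked for each, are
described by paths of a finite subgraph of a Schreier graph. -/
theorem exists_permGraph_of_subgroups {α ι : Type u} [Finite ι] (K : ι → Subgroup (FreeGroup α))
    (T : ι → Finset (FreeGroup α)) :
    ∃ (X : Type u) (_ : Finite X) (Γ : PermGraph α X) (b : ι → X),
      (∀ i g, Γ.Seg (translation α) (b i) (b i) 1 g → g ∈ K i) ∧
      ∀ i, ∀ t ∈ T i, ∃ c, Γ.Seg (translation α) (b i) c 1 t ∧ (t ∈ K i → c = b i) ∧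
        ∀ g, Γ.Seg (translation α) (b i) c 1 g → t * g⁻¹ ∈ K i := by
  classical
  have := Fintype.ofFinite ι
  let f : α → Perm (Σ i, FreeGroup α ⧸ K i) := fun a =>
    Equiv.sigmaCongrRight fun i => MulAction.toPerm (FreeGroup.of a)⁻¹
  have hrun : ∀ i w (g : FreeGroup α), run f w ⟨i, (g⁻¹ : FreeGroup α)⟩ =
      ⟨i, ((g * FreeGroup.mk w)⁻¹ : FreeGroup α)⟩ := by
    intro i w g
    have := map_run (f := translation α) (g := f)
      (fun g => (⟨i, (g⁻¹ : FreeGroup α)⟩ : Σ i, FreeGroup α ⧸ K i)) ?_ w g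
    · rw [← this, run_translation]
    · intro a g
      simp only [translation, Equiv.coe_mulRight, mul_inv_rev]
      rfl
  let V : Finset (Σ i, FreeGroup α ⧸ K i) := Finset.univ.biUnion fun i =>
    (insert 1 (T i)).biUnion fun t =>
      (t.toWord.inits.map fun u => run f u ⟨i, (1⁻¹ : FreeGroup α)⟩).toFinset
  have hV : ∀ i, ∀ t ∈ insert 1 (T i), ∀ u, u <+: t.toWord →
      run f u ⟨i, (1⁻¹ : FreeGroup α)⟩ ∈ V := by
    intro i t ht u hu
    simp only [V, Finset.mem_biUnion, List.mem_toFinset, List.mem_map, List.mem_inits]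
    exact ⟨i, Finset.mem_univ i, t, ht, u, hu, rfl⟩
  obtain ⟨Γ, hΓ, hΓ'⟩ := exists_permGraph f V
  let b : ι → V := fun i => ⟨_, hV i 1 (Finset.mem_insert_self _ _) [] List.nil_prefix⟩
  have hseg : ∀ i (t : FreeGroup α) (c : V),
      (c : Σ i, FreeGroup α ⧸ K i) = ⟨i, (t⁻¹ : FreeGroup α)⟩ →
        ∀ g, Γ.Seg (translation α) (b i) c 1 g → t * g⁻¹ ∈ K i := by
    rintro i t c hc g ⟨w, hw, hg⟩
    have h := hΓ _ _ _ hw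
    rw [run_translation, one_mul] at hg
    change run f w ⟨i, (1⁻¹ : FreeGroup α)⟩ = _ at h
    rw [hrun, hc, one_mul, hg] at h
    have h' := eq_of_heq (Sigma.mk.inj h).2
    simpa using QuotientGroup.eq.1 h'.symm
  refine ⟨V, inferInstance, Γ, b, fun i g hg => ?_, fun i t ht => ?_⟩
  · simpa using hseg i 1 (b i) rfl g hg
  · have ht' := Finset.mem_insert_of_mem (b := 1) ht
    have hend : run f t.toWord ⟨i, (1⁻¹ : FreeGroup α)⟩ = ⟨i, (t⁻¹ : FreeGroup α)⟩ := by
      rw [hrun, one_mul, FreeGroup.mk_toWord]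
    refine ⟨⟨_, hV i t ht' _ (List.prefix_refl _)⟩,
      ⟨t.toWord, hΓ' _ _ _ (hV i t ht') rfl, ?_⟩, fun htK => ?_, hseg i t _ hend⟩
    · rw [run_translation, one_mul, FreeGroup.mk_toWord]
    · refine Subtype.ext (hend.trans ?_)
      change _ = (⟨i, (1⁻¹ : FreeGroup α)⟩ : Σ i, FreeGroup α ⧸ K i)
      congr 1
      exact QuotientGroup.eq.2 (by simpa using htK)

open PermGraph

/-- If every element of `T` labels a loop at `b`, so does every element of the subgroup
generated by `T`. -/
lemma seg_of_mem_closure {Γ : PermGraph α X} {b : X} {T : Set (FreeGroup α)}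
    (hT : ∀ t ∈ T, Γ.Seg (translation α) b b 1 t) {g : FreeGroup α}
    (hg : g ∈ Subgroup.closure T) : Γ.Seg (translation α) b b 1 g := by
  induction hg using Subgroup.closure_induction with
  | mem t ht => exact hT t ht
  | one => exact Seg.refl b 1
  | mul g h _ _ ihg ihh => exact ihg.trans (by simpa using ihh.translate g)
  | inv g _ ih => simpa using ih.symm.translate g⁻¹

lemma chain_ofFn_iff {Γ : PermGraph α X} {s : ℕ} (b : Fin s → X) (g g' : FreeGroup α) :
    Γ.Chain (translation α) (List.ofFn fun i => (b i, b i)) g g' ↔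
      ∃ h : Fin s → FreeGroup α, (∀ i, Γ.Seg (translation α) (b i) (b i) 1 (h i)) ∧
        g * (List.ofFn h).prod = g' := by
  induction s generalizing g with
  | zero => simp [Chain]
  | succ s ih =>
    rw [List.ofFn_succ]
    constructor
    · rintro ⟨k, hk, hL⟩
      obtain ⟨h, hh, rfl⟩ := (ih _ _).1 hL
      refine ⟨Fin.cons (g⁻¹ * k) h, Fin.cases (by simpa using hk.translate g⁻¹) hh, ?_⟩
      simp [mul_assoc]
    · rintro ⟨h, hh, rfl⟩
      refine ⟨g * h 0, by simpa using (hh 0).translate g, (ih _ _).2 ⟨fun i => h i.succ,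
        fun i => hh i.succ, ?_⟩⟩
      simp [List.ofFn_succ, mul_assoc]

/-- An element outside a product of finitely generated subgroups of a free group of finite rank is
separated from it in a finite quotient. -/
theorem exists_normal_finiteIndex {α : Type} [Finite α] {s : ℕ}
    (H : Fin s → Subgroup (FreeGroup α)) (hfg : ∀ i, (H i).FG) (w : FreeGroup α)
    (hw : ¬∃ h : Fin s → FreeGroup α, (∀ i, h i ∈ H i) ∧ (List.ofFn h).prod = w) :
    ∃ N : Subgroup (FreeGroup α), N.Normal ∧ N.FiniteIndex ∧
      ∀ m ∈ N, ¬∃ h : Fin s → FreeGroup α, (∀ i, h i ∈ H i) ∧ (List.ofFn h).prod = w * m := by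
  choose T hT using hfg
  obtain ⟨X, _, Γ, b, hb, hc⟩ := exists_permGraph_of_subgroups
    (fun i : Option (Fin s) => i.elim ⊥ H) (fun i => i.elim {w⁻¹} T)
  obtain ⟨c, hwc, -, hc'⟩ := hc none w⁻¹ (by simp)
  obtain ⟨Y, _, ⟨y⟩, f, -, hf⟩ := exists_resolves Γ s
  let φ : FreeGroup α →* Perm Y := FreeGroup.lift fun a => (f a)⁻¹
  refine ⟨φ.ker, inferInstance, inferInstance, ?_⟩
  rintro m hm ⟨h, hh, hprod⟩
  let L : List (X × X) := (List.ofFn fun i => (b (some i), b (some i))) ++ [(b none, c)]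
  have hL : Γ.Chain (translation α) L 1 (w * m * w⁻¹) := by
    refine Chain.snoc ((chain_ofFn_iff _ 1 (w * m)).2 ⟨h, fun i => ?_, by rw [one_mul, hprod]⟩)
      (by simpa using hwc.translate (w * m))
    refine seg_of_mem_closure (T := T i) (fun t ht => ?_) (by rw [hT i]; exact hh i)
    obtain ⟨c, hc₁, hc₂, -⟩ := hc (some i) t ht
    rwa [hc₂ ((hT i).le (Subgroup.subset_closure ht))] at hc₁
  have hLY : Γ.Chain f L y y := by
    have := hL.map (g := f) (fun g => (φ g)⁻¹ y) fun a g => by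
      simp [translation, φ]
    have hm' : φ m = 1 := hm
    simpa [hm'] using this
  obtain ⟨k, hk, hlast⟩ := chain_append.1 ((hf L (by simp [L]) y hLY).chain 1)
  obtain ⟨h', hh', rfl⟩ := (chain_ofFn_iff _ _ _).1 hk
  refine hw ⟨h', fun i => hb (some i) _ (hh' i), ?_⟩
  have := hc' _ (by simpa using (chain_singleton.1 hlast).translate (1 * (List.ofFn h').prod)⁻¹)
  have h1 : w⁻¹ * (List.ofFn h').prod = 1 := by simpa using this
  exact (inv_mul_eq_one.1 h1).symm

end RibesZalesskii

/-- **Ribes–Zalesskiĭ theorem** (Pin–Reutenauer conjecture): in a free group of finite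
rank, the product of finitely many finitely generated subgroups is separable, i.e.
closed in the profinite topology. -/
theorem product_of_fg_subgroups_separable_in_free_group
    (n : ℕ) (s : ℕ) (hs : 0 < s) (Hs : Fin s → Subgroup (FreeGroup (Fin n)))
    (hfg : ∀ i, (Hs i).FG) :
    SeparableSubset (FreeGroup (Fin n))
      {g : FreeGroup (Fin n) |
        ∃ f : Fin s → FreeGroup (Fin n), (∀ i, f i ∈ Hs i) ∧ (List.ofFn f).prod = g} := by
  let := profiniteTopology (FreeGroup (Fin n))
  refine ⟨isOpen_iff_forall_mem_open.2 fun w hw => ?_⟩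
  obtain ⟨N, hN, hfin, hsep⟩ := RibesZalesskii.exists_normal_finiteIndex Hs hfg w hw
  refine ⟨w • (N : Set _), ?_, TopologicalSpace.isOpen_generateFrom_of_mem ⟨w, N, hN, hfin, rfl⟩,
    Set.mem_smul_set.2 ⟨1, N.one_mem, mul_one w⟩⟩
  rintro _ ⟨m, hm, rfl⟩
  exact hsep m hm
end
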